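/- (Conditional bound for ψ(x).) Fix ε with 0 ≤ ε < 1/2. If every zero s of the Riemann zeta function with 0 < Re(s) < 1 satisfies Re(s) ≤ 1/2 + ε, then there exists a constant C > 0 such that for all real x ≥ 2, |ψ(x) - x| ≤ C·x^{1/2+ε}·(log x)², where ψ(x) = Σ_{n ≤ x} Λ(n) is the Chebyshev function. -/

import Mathlib

section

open Complex Set Filter Topology MeasureTheory Metric

/-- The entire function `(s - 1) ζ(s)`. -/
noncomputable def zetaEntire : ℂ → ℂ :=
  Function.update (fun s => (s - 1) * riemannZeta s) 1 1

lemma zetaEntire_of_ne {s : ℂ} (hs : s ≠ 1) : zetaEntire s = (s - 1) * riemannZeta s := by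
  simp [zetaEntire, hs]

lemma zetaEntire_one : zetaEntire 1 = 1 := by simp [zetaEntire]

lemma zetaEntire_eventuallyEq {s : ℂ} (hs : s ≠ 1) :
    zetaEntire =ᶠ[𝓝 s] fun s => (s - 1) * riemannZeta s := by
  filter_upwards [isOpen_ne.mem_nhds hs] with z hz using zetaEntire_of_ne hz

lemma differentiable_zetaEntire : Differentiable ℂ zetaEntire := by
  have h1 : ∀ s ≠ (1 : ℂ), DifferentiableAt ℂ zetaEntire s := fun s hs =>
    ((differentiableAt_id.sub_const 1).mul (differentiableAt_riemannZeta hs)).congr_of_eventuallyEq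
      (zetaEntire_eventuallyEq hs)
  intro s
  by_cases hs : s = 1
  · subst hs
    refine (Complex.analyticAt_of_differentiable_on_punctured_nhds_of_continuousAt ?_ ?_).differentiableAt
    · filter_upwards [self_mem_nhdsWithin] with z hz using h1 z hz
    · rw [zetaEntire, continuousAt_update_same]
      exact riemannZeta_residue_one
  · exact h1 s hs

/-- The Mellin transform controlling `ζ` to the left of `Re s = 1`. -/
noncomputable def fractTail : ℝ → ℂ :=
  (Ioi (1 : ℝ)).indicator fun u => ((Int.fract u : ℝ) : ℂ)

lemma norm_fractTail_le (u : ℝ) : ‖fractTail u‖ ≤ 1 := by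
  unfold fractTail
  by_cases h : u ∈ Ioi (1 : ℝ)
  · rw [indicator_of_mem h, Complex.norm_real, Real.norm_eq_abs, abs_of_nonneg (Int.fract_nonneg _)]
    exact (Int.fract_lt_one _).le
  · simp [indicator_of_notMem h]

lemma measurable_fractTail : Measurable fractTail :=
  (Complex.measurable_ofReal.comp measurable_fract).indicator measurableSet_Ioi

lemma mellin_fractTail (s : ℂ) :
    mellin fractTail s = ∫ t in Ioi (1 : ℝ), (t : ℂ) ^ (s - 1) * ((Int.fract t : ℝ) : ℂ) := by
  unfold mellin fractTail
  have : ∀ t : ℝ, (t : ℂ) ^ (s - 1) • (Ioi (1 : ℝ)).indicator (fun u => ((Int.fract u : ℝ) : ℂ)) t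
      = (Ioi (1 : ℝ)).indicator (fun t : ℝ => (t : ℂ) ^ (s - 1) * ((Int.fract t : ℝ) : ℂ)) t := by
    intro t
    by_cases h : t ∈ Ioi (1 : ℝ) <;> simp [h]
  simp_rw [this]
  rw [setIntegral_indicator measurableSet_Ioi, Ioi_inter_Ioi]
  simp

lemma differentiableAt_mellin_fractTail {s : ℂ} (hs : s.re < 0) :
    DifferentiableAt ℂ (mellin fractTail) s := by
  refine mellin_differentiableAt_of_isBigO_rpow (a := 0) (b := s.re - 1) ?_ ?_ hs ?_ (by linarith)
  · refine LocallyIntegrable.locallyIntegrableOn ?_ _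
    refine (locallyIntegrable_const (1 : ℝ)).mono measurable_fractTail.aestronglyMeasurable ?_
    exact Eventually.of_forall fun u => by simpa using norm_fractTail_le u
  · refine Asymptotics.IsBigO.of_bound 1 (Eventually.of_forall fun u => ?_)
    simpa using norm_fractTail_le u
  · refine Asymptotics.IsBigO.of_bound 1 ?_
    filter_upwards [Ioo_mem_nhdsGT (show (0 : ℝ) < 1 by norm_num)] with u hu
    have : u ∉ Ioi (1 : ℝ) := by simpa using hu.2.le
    simp [fractTail, this]

lemma norm_mellin_fractTail_le {s : ℂ} (hs : 0 < s.re) :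
    ‖mellin fractTail (-s)‖ ≤ 1 / s.re := by
  rw [mellin_fractTail]
  refine (norm_integral_le_of_norm_le (integrableOn_Ioi_rpow_of_lt (a := -s.re - 1) (by linarith)
    one_pos) ?_).trans ?_
  · filter_upwards [ae_restrict_mem measurableSet_Ioi] with t ht
    have ht0 : 0 < t := one_pos.trans ht
    rw [norm_mul, Complex.norm_cpow_eq_rpow_re_of_pos ht0, Complex.norm_real, Real.norm_eq_abs,
      abs_of_nonneg (Int.fract_nonneg _)]
    have := (Int.fract_lt_one t).le
    have h0 : 0 ≤ t ^ (-s - 1).re := by positivity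
    calc _ ≤ t ^ (-s - 1).re * 1 := by gcongr
      _ = _ := by simp
  · rw [integral_Ioi_rpow_of_lt (by linarith) one_pos]
    simp [neg_div_neg_eq]

lemma riemannZeta_eq_of_one_lt_re {s : ℂ} (hs : 1 < s.re) :
    riemannZeta s = s / (s - 1) - s * mellin fractTail (-s) := by
  have hs1 : s - 1 ≠ 0 := fun h => by
    rw [sub_eq_zero.mp h] at hs; simp at hs
  have h := LSeries_eq_mul_integral' (fun _ => (1 : ℂ)) (r := 1) zero_le_one hs ?_
  · have hz : LSeries (fun _ => (1 : ℂ)) s = riemannZeta s := LSeries_one_eq_riemannZeta hs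
    have hi1 : IntegrableOn (fun t : ℝ => (t : ℂ) ^ (-s)) (Ioi 1) :=
      integrableOn_Ioi_cpow_of_lt (by simpa using hs) one_pos
    have hi2 : IntegrableOn (fun t : ℝ => (t : ℂ) ^ (-s - 1) * ((Int.fract t : ℝ) : ℂ))
        (Ioi 1) := by
      refine Integrable.mono' (integrableOn_Ioi_rpow_of_lt (a := -s.re - 1) (by linarith)
        one_pos) ?_ ?_
      · exact (ContinuousOn.aestronglyMeasurable (fun t ht => (Complex.continuousAt_ofReal_cpow_const
          _ _ (Or.inr (one_pos.trans ht).ne')).continuousWithinAt) measurableSet_Ioi).mul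
          (Complex.measurable_ofReal.comp measurable_fract).aestronglyMeasurable
      · filter_upwards [ae_restrict_mem measurableSet_Ioi] with t ht
        have ht0 : 0 < t := one_pos.trans ht
        rw [norm_mul, Complex.norm_cpow_eq_rpow_re_of_pos ht0, Complex.norm_real,
          Real.norm_eq_abs, abs_of_nonneg (Int.fract_nonneg _)]
        have := (Int.fract_lt_one t).le
        have h0 : 0 ≤ t ^ (-s - 1).re := by positivity
        calc _ ≤ t ^ (-s - 1).re * 1 := by gcongr
          _ = _ := by simp
    rw [← hz, h, mellin_fractTail]
    have : ∀ t ∈ Ioi (1 : ℝ), (∑ k ∈ Finset.Icc 1 ⌊t⌋₊, (1 : ℂ)) * (t : ℂ) ^ (-(s + 1))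
        = (t : ℂ) ^ (-s) - (t : ℂ) ^ (-s - 1) * ((Int.fract t : ℝ) : ℂ) := by
      intro t ht
      have ht0 : 0 < t := one_pos.trans ht
      have h1 : ((⌊t⌋₊ : ℝ)) = t - Int.fract t := by
        rw [← Int.self_sub_floor, sub_sub_cancel, natCast_floor_eq_intCast_floor ht0.le]
      have h2 : ((⌊t⌋₊ : ℂ)) = (t : ℂ) - (Int.fract t : ℝ) := by
        rw [← Complex.ofReal_sub, ← h1]; simp
      have h3 : (t : ℂ) ^ (-s) = (t : ℂ) ^ (-s - 1) * t := by
        conv_lhs => rw [show -s = (-s - 1) + 1 by ring]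
        rw [Complex.cpow_add _ _ (by exact_mod_cast ht0.ne'), Complex.cpow_one]
      rw [Finset.sum_const, Nat.card_Icc, nsmul_eq_mul, mul_one, Nat.add_sub_cancel, h2, h3,
        neg_add']
      ring
    rw [setIntegral_congr_fun measurableSet_Ioi this, integral_sub hi1 hi2,
      integral_Ioi_cpow_of_lt (by simpa using hs) one_pos, mul_sub]
    congr 1
    have : -s + 1 ≠ 0 := fun h => hs1 (by linear_combination -h)
    simp only [ofReal_one, one_cpow]
    field_simp
    ring
  · refine Asymptotics.IsBigO.of_bound 1 (Eventually.of_forall fun n => ?_)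
    simp

lemma zetaEntire_eq {s : ℂ} (hs : 0 < s.re) :
    zetaEntire s = s - s * (s - 1) * mellin fractTail (-s) := by
  have hU : IsOpen {s : ℂ | 0 < s.re} := isOpen_lt continuous_const Complex.continuous_re
  have h1 : AnalyticOnNhd ℂ zetaEntire {s : ℂ | 0 < s.re} :=
    differentiable_zetaEntire.differentiableOn.analyticOnNhd hU
  have h2 : AnalyticOnNhd ℂ (fun s => s - s * (s - 1) * mellin fractTail (-s))
      {s : ℂ | 0 < s.re} := by
    refine DifferentiableOn.analyticOnNhd (fun z hz => ?_) hU
    have : DifferentiableAt ℂ (fun s => mellin fractTail (-s)) z :=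
      DifferentiableAt.fun_comp' (g := mellin fractTail) z
        (differentiableAt_mellin_fractTail (by simpa using hz)) differentiableAt_id.neg
    exact (differentiableAt_id.sub ((differentiableAt_id.mul
      (differentiableAt_id.sub_const 1)).mul this)).differentiableWithinAt
  refine h1.eqOn_of_preconnected_of_eventuallyEq h2
    (convex_halfSpace_re_gt 0).isPreconnected (z₀ := 2) (by simp) ?_ hs
  have : {s : ℂ | 1 < s.re} ∈ 𝓝 (2 : ℂ) :=
    (isOpen_lt continuous_const Complex.continuous_re).mem_nhds (by simp)
  filter_upwards [this] with z hz
  have hz1 : z ≠ 1 := fun h => by rw [h] at hz; simp at hz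
  rw [zetaEntire_of_ne hz1, riemannZeta_eq_of_one_lt_re hz]
  have := sub_ne_zero.mpr hz1
  field_simp

lemma norm_zetaEntire_le {s : ℂ} (h1 : 1 / 16 ≤ s.re) (h2 : s.re ≤ 4) :
    ‖zetaEntire s‖ ≤ 272 * (|s.im| + 2) ^ 2 := by
  have hs : ‖s‖ ≤ |s.im| + 4 :=
    (Complex.norm_le_abs_re_add_abs_im s).trans (by rw [abs_of_nonneg (by linarith)]; linarith)
  have hs1 : ‖s - 1‖ ≤ |s.im| + 3 := by
    refine (Complex.norm_le_abs_re_add_abs_im _).trans ?_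
    have : |(s - 1).re| ≤ 3 := by rw [abs_le]; simp; constructor <;> linarith
    simp only [sub_im, one_im, sub_zero]
    linarith
  have hm : ‖mellin fractTail (-s)‖ ≤ 16 := by
    refine (norm_mellin_fractTail_le (by linarith)).trans ?_
    rw [div_le_iff₀ (by linarith)]; linarith
  have h0 := abs_nonneg s.im
  rw [zetaEntire_eq (by linarith)]
  calc _ ≤ ‖s‖ + ‖s‖ * ‖s - 1‖ * ‖mellin fractTail (-s)‖ := by
        refine (norm_sub_le _ _).trans ?_
        rw [norm_mul, norm_mul]
    _ ≤ (|s.im| + 4) + (|s.im| + 4) * (|s.im| + 3) * 16 := by gcongr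
    _ ≤ _ := by nlinarith

lemma zetaEntire_ne_zero_of_one_le_re {s : ℂ} (hs : 1 ≤ s.re) : zetaEntire s ≠ 0 := by
  by_cases h : s = 1
  · simp [h, zetaEntire_one]
  · rw [zetaEntire_of_ne h]
    exact mul_ne_zero (sub_ne_zero.mpr h) (riemannZeta_ne_zero_of_one_le_re hs)

lemma re_le_of_zetaEntire_eq_zero {θ : ℝ}
    (hzeta : ∀ s : ℂ, riemannZeta s = 0 → 0 < s.re → s.re < 1 → s.re ≤ θ)
    {s : ℂ} (h : zetaEntire s = 0) (hs : 0 < s.re) : s.re ≤ θ := by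
  have h1 : s.re < 1 := by
    by_contra h1
    exact zetaEntire_ne_zero_of_one_le_re (not_lt.mp h1) h
  have hne : s ≠ 1 := fun h => by rw [h] at h1; simp at h1
  rw [zetaEntire_of_ne hne] at h
  exact hzeta s ((mul_eq_zero.mp h).resolve_left (sub_ne_zero.mpr hne)) hs h1

lemma exists_le_norm_zetaEntire :
    ∃ c : ℝ, 0 < c ∧ ∀ s : ℂ, s.re = 2 → c ≤ ‖zetaEntire s‖ := by
  set B : ℝ := ∑' n : ℕ, ‖LSeries.term (fun _ => 1) 2 n‖ with hB
  have hsum : Summable fun n : ℕ => ‖LSeries.term (fun _ => (1 : ℂ)) 2 n‖ :=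
    ((LSeriesSummable_one_iff (s := 2)).mpr (by simp)).norm
  refine ⟨1 / (B + 1), ?_, fun s hs => ?_⟩
  · have : 0 ≤ B := tsum_nonneg fun _ => norm_nonneg _
    positivity
  have hB0 : 0 ≤ B := tsum_nonneg fun _ => norm_nonneg _
  have h1 : 1 < s.re := by rw [hs]; norm_num
  have hM := ArithmeticFunction.LSeriesSummable_moebius_iff.mpr h1
  have hle : ‖LSeries (fun n => ((ArithmeticFunction.moebius n : ℤ) : ℂ)) s‖ ≤ B := by
    refine tsum_of_norm_bounded hsum.hasSum fun n => ?_
    refine (LSeries.norm_term_le_of_re_le_re _ (s := 2) (s' := s) (by simp [hs]) n).trans ?_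
    refine LSeries.norm_term_le _ ?_
    simp only [norm_one]
    rw [Complex.norm_intCast]
    exact_mod_cast ArithmeticFunction.abs_moebius_le_one
  have hmul := ArithmeticFunction.LSeries_zeta_mul_Lseries_moebius h1
  rw [ArithmeticFunction.LSeries_zeta_eq_riemannZeta h1] at hmul
  have hne : s ≠ 1 := fun h => by rw [h] at h1; simp at h1
  rw [zetaEntire_of_ne hne, norm_mul, div_le_iff₀ (by positivity)]
  have hn : ‖riemannZeta s‖ * ‖LSeries (fun n => ((ArithmeticFunction.moebius n : ℤ) : ℂ)) s‖ = 1 := by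
    rw [← norm_mul, hmul, norm_one]
  have hge : 1 ≤ ‖s - 1‖ := by
    have := Complex.abs_re_le_norm (s - 1)
    rw [sub_re, hs] at this
    norm_num at this
    exact this
  calc 1 = 1 * (‖riemannZeta s‖ * ‖LSeries (fun n => ((ArithmeticFunction.moebius n : ℤ) : ℂ)) s‖) := by
        rw [hn, one_mul]
    _ ≤ ‖s - 1‖ * (‖riemannZeta s‖ * (B + 1)) := by gcongr; linarith
    _ = _ := by ring

lemma exists_entire_factor_pow {f : ℂ → ℂ} (hf : Differentiable ℂ f) {ρ : ℂ}
    (h : analyticOrderAt f ρ ≠ ⊤) :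
    ∃ g : ℂ → ℂ, Differentiable ℂ g ∧ g ρ ≠ 0 ∧
      ∀ s, f s = (s - ρ) ^ analyticOrderNatAt f ρ * g s := by
  have hfa : AnalyticAt ℂ f ρ := hf.analyticAt ρ
  obtain ⟨g₀, hg₀, hne, heq⟩ := (hfa.analyticOrderAt_ne_top).mp h
  set n := analyticOrderNatAt f ρ
  set g : ℂ → ℂ := Function.update (fun s => f s / (s - ρ) ^ n) ρ (g₀ ρ) with hg
  have hloc : g =ᶠ[𝓝 ρ] g₀ := by
    filter_upwards [heq] with z hz
    by_cases hzρ : z = ρ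
    · simp [hg, hzρ]
    · have : (z - ρ) ^ n ≠ 0 := pow_ne_zero _ (sub_ne_zero.mpr hzρ)
      simp [hg, hzρ, hz, this]
  refine ⟨g, fun s => ?_, by simpa [hg] using hne, fun s => ?_⟩
  · by_cases hs : s = ρ
    · subst hs
      exact hg₀.differentiableAt.congr_of_eventuallyEq hloc
    · have : g =ᶠ[𝓝 s] fun s => f s / (s - ρ) ^ n := by
        filter_upwards [isOpen_ne.mem_nhds hs] with z hz
        simp [hg, hz]
      refine DifferentiableAt.congr_of_eventuallyEq ?_ this
      exact (hf s).div ((differentiableAt_id.sub_const ρ).pow n)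
        (pow_ne_zero _ (sub_ne_zero.mpr hs))
  · by_cases hs : s = ρ
    · subst hs
      simpa [hg] using heq.self_of_nhds
    · have : (s - ρ) ^ n ≠ 0 := pow_ne_zero _ (sub_ne_zero.mpr hs)
      simp only [hg, Function.update_of_ne hs]
      field_simp

lemma exists_entire_factor {f : ℂ → ℂ} (hf : Differentiable ℂ f)
    (h : ∀ ρ, analyticOrderAt f ρ ≠ ⊤) (S : Finset ℂ) :
    ∃ g : ℂ → ℂ, Differentiable ℂ g ∧ (∀ ρ ∈ S, g ρ ≠ 0) ∧
      ∀ s, f s = (∏ ρ ∈ S, (s - ρ) ^ analyticOrderNatAt f ρ) * g s := by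
  classical
  induction S using Finset.induction_on with
  | empty => exact ⟨f, hf, by simp, by simp⟩
  | insert σ S hσ ih =>
    obtain ⟨g, hg, hgS, hfg⟩ := ih
    set P : ℂ → ℂ := fun s => ∏ ρ ∈ S, (s - ρ) ^ analyticOrderNatAt f ρ with hP
    have hPd : Differentiable ℂ P := by
      rw [hP]
      fun_prop
    have hPσ : P σ ≠ 0 := Finset.prod_ne_zero_iff.mpr fun ρ hρ =>
      pow_ne_zero _ (sub_ne_zero.mpr fun h => hσ (h ▸ hρ))
    have hord : analyticOrderAt f σ = analyticOrderAt g σ := by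
      have : f = P * g := funext hfg
      conv_lhs => rw [this]
      rw [analyticOrderAt_mul (hPd.analyticAt σ) (hg.analyticAt σ),
        (hPd.analyticAt σ).analyticOrderAt_eq_zero.mpr hPσ, zero_add]
    obtain ⟨g₁, hg₁, hg₁σ, hgg₁⟩ := exists_entire_factor_pow hg (ρ := σ) (hord ▸ h σ)
    refine ⟨g₁, hg₁, fun ρ hρ => ?_, fun s => ?_⟩
    · rcases Finset.mem_insert.mp hρ with rfl | hρ
      · exact hg₁σ
      · exact fun h0 => hgS ρ hρ (by rw [hgg₁, h0, mul_zero])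
    · rw [Finset.prod_insert hσ, hfg, hgg₁]
      simp only [analyticOrderNatAt, hord]
      ring

lemma sum_analyticOrderNatAt_le {f : ℂ → ℂ} (hf : Differentiable ℂ f) {c : ℂ} (hc : f c ≠ 0)
    {r R Λ : ℝ} (hr : 0 < r) (hrR : r < R) (hΛ : 0 ≤ Λ)
    (hb : ∀ z ∈ closedBall c R, ‖f z‖ ≤ Real.exp Λ * ‖f c‖) (S : Finset ℂ)
    (hS : ∀ ρ ∈ S, ρ ∈ closedBall c r) :
    ∑ ρ ∈ S, (analyticOrderNatAt f ρ : ℝ) ≤ Λ / Real.log (R / r) := by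
  classical
  have hR : 0 < R := hr.trans hrR
  set F : ℂ → ℂ := fun z => (f c)⁻¹ * f z with hF
  have hFd : Differentiable ℂ F := hf.const_mul _
  have hFc : F c = 1 := by simp [hF, hc]
  have hord : ∀ ρ, analyticOrderAt F ρ = analyticOrderAt f ρ := by
    intro ρ
    have h1 : AnalyticAt ℂ (fun _ : ℂ => (f c)⁻¹) ρ := analyticAt_const
    have := analyticOrderAt_mul h1 (hf.analyticAt ρ)
    rw [h1.analyticOrderAt_eq_zero.mpr (inv_ne_zero hc), zero_add] at this
    exact this
  have hJ := AnalyticOnNhd.sum_divisor_le (c := c) (r := r) (R := R) (M := Real.exp Λ) (f := F)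
    (abs_pos.mpr hr.ne') (by rwa [abs_of_pos hr, abs_of_pos hR]) (Real.one_le_exp hΛ)
    (fun z _ => hFd.analyticAt z) (by rw [hFc]; exact one_ne_zero) ?_
  · rw [hFc, norm_one, div_one, Real.log_exp, abs_of_pos hr] at hJ
    refine le_trans ?_ hJ
    have hFa : AnalyticOnNhd ℂ F (closedBall c r) := fun z _ => hFd.analyticAt z
    have hfin := (MeromorphicOn.divisor F (closedBall c r)).finiteSupport
      (isCompact_closedBall c r)
    rw [finsum_eq_sum_of_support_subset (s := S ∪ hfin.toFinset) _ (by simp)]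
    have h1 : ∑ ρ ∈ S, (analyticOrderNatAt f ρ : ℤ) =
        ∑ ρ ∈ S, MeromorphicOn.divisor F (closedBall c r) ρ := by
      refine Finset.sum_congr rfl fun ρ hρ => ?_
      rw [MeromorphicOn.AnalyticOnNhd.divisor_apply hFa (hS ρ hρ), hord, analyticOrderNatAt]
      cases analyticOrderAt f ρ <;> simp
    have h2 := Finset.sum_le_sum_of_subset_of_nonneg (f := MeromorphicOn.divisor F (closedBall c r))
      (Finset.subset_union_left (s₁ := S) (s₂ := hfin.toFinset))
      (fun ρ _ _ => MeromorphicOn.AnalyticOnNhd.divisor_nonneg hFa ρ)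
    rw [← h1] at h2
    exact_mod_cast h2
  · intro z hz
    rw [abs_of_pos hR] at hz
    have := hb z (sphere_subset_closedBall hz)
    rw [hF, norm_mul, norm_inv, inv_mul_le_iff₀ (norm_pos_iff.mpr hc)]
    linarith

/-- A function without zeros on a disc has small logarithmic derivative, provided it is not much
larger than its value at the centre. -/
lemma norm_logDeriv_le_of_ne_zero {g : ℂ → ℂ} (hg : Differentiable ℂ g) {c : ℂ} {Λ : ℝ}
    (hΛ : 0 < Λ) (hne : ∀ z ∈ ball c (7 / 4), g z ≠ 0)
    (hb : ∀ z ∈ ball c (7 / 4), ‖g z‖ ≤ Real.exp Λ * ‖g c‖) {s : ℂ}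
    (hs : s ∈ closedBall c (3 / 2)) : ‖logDeriv g s‖ ≤ 208 * Λ := by
  have hcb : c ∈ ball c (7 / 4 : ℝ) := mem_ball_self (by norm_num)
  have hgd : Differentiable ℂ (deriv g) := fun z =>
    ((hg.analyticAt z).deriv).differentiableAt
  have hL : DifferentiableOn ℂ (logDeriv g) (ball c (7 / 4)) := fun z hz =>
    ((hgd z).div (hg z) (hne z hz)).differentiableWithinAt
  obtain ⟨φ, hφc, hφ⟩ := hL.isExactOn_ball.with_val_at c 0
  have hexp : ∀ z ∈ ball c (7 / 4 : ℝ), g z = g c * Complex.exp (φ z) := by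
    have hconst : ∀ z ∈ ball c (7 / 4 : ℝ), g z * Complex.exp (-φ z) = g c := by
      intro z hz
      have hd : ∀ w ∈ ball c (7 / 4 : ℝ),
          HasDerivAt (fun w => g w * Complex.exp (-φ w)) 0 w := by
        intro w hw
        convert! (hg w).hasDerivAt.mul ((hφ w hw).neg.cexp) using 1
        rw [logDeriv_apply]
        have := hne w hw
        field_simp
        ring
      have := (convex_ball c (7 / 4)).is_const_of_fderivWithin_eq_zero (𝕜 := ℂ)
        (f := fun w => g w * Complex.exp (-φ w))
        (fun w hw => (hd w hw).differentiableAt.differentiableWithinAt)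
        (fun w hw => by
          rw [fderivWithin_of_isOpen isOpen_ball hw]
          exact ((hd w hw).hasFDerivAt.fderiv).trans (by ext; simp)) hz hcb
      simpa [hφc] using this
    intro z hz
    rw [← hconst z hz, mul_assoc, ← Complex.exp_add]
    simp
  have hre : ∀ z ∈ ball c (7 / 4 : ℝ), (φ z).re ≤ Λ := by
    intro z hz
    have h1 := hb z hz
    rw [hexp z hz, norm_mul, Complex.norm_exp, mul_comm] at h1
    exact Real.exp_le_exp.mp (le_of_mul_le_mul_right h1 (norm_pos_iff.mpr (hne c hcb)))
  have hφle : ∀ z ∈ closedBall c (13 / 8 : ℝ), ‖φ z‖ ≤ 26 * Λ := by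
    intro z hz
    have hmaps : ∀ w ∈ ball (0 : ℂ) (7 / 4 : ℝ), c + w ∈ ball c (7 / 4 : ℝ) := by
      intro w hw
      simpa [mem_ball_iff_norm] using hw
    have hz' : ‖z - c‖ ≤ 13 / 8 := mem_closedBall_iff_norm.mp hz
    have := Complex.borelCaratheodory_zero (f := fun w => φ (c + w)) (M := Λ) (R := 7 / 4)
      (z := z - c) hΛ
      (fun w hw => ((hφ _ (hmaps w hw)).comp_const_add c w).differentiableAt.differentiableWithinAt)
      (fun w hw => hre _ (hmaps w hw)) (by norm_num)
      (by rw [mem_ball_zero_iff]; linarith) (by simp [hφc])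
    simp only [add_sub_cancel] at this
    refine this.trans ?_
    rw [div_le_iff₀ (by linarith)]
    nlinarith
  have hsb : ∀ z ∈ closedBall s (1 / 8 : ℝ), z ∈ closedBall c (13 / 8 : ℝ) := by
    intro z hz
    rw [mem_closedBall] at *
    linarith [dist_triangle z s c]
  have hsub : closedBall c (13 / 8 : ℝ) ⊆ ball c (7 / 4) := closedBall_subset_ball (by norm_num)
  have hs' : s ∈ ball c (7 / 4 : ℝ) := hsub (hsb s (mem_closedBall_self (by norm_num)))
  rw [← (hφ s hs').deriv]
  refine (Complex.norm_deriv_le_of_forall_mem_sphere_norm_le (R := 1 / 8) (C := 26 * Λ)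
    (by norm_num) ?_ fun z hz => hφle z (hsb z (sphere_subset_closedBall hz))).trans ?_
  · refine DifferentiableOn.diffContOnCl_ball (U := ball c (7 / 4)) (fun z hz =>
      (hφ z hz).differentiableAt.differentiableWithinAt) fun z hz => hsub (hsb z hz)
  · rw [div_le_iff₀ (by norm_num)]; linarith

/-- Landau's local formula for the logarithmic derivative. -/
lemma exists_norm_logDeriv_sub_sum_le : ∃ C : ℝ, 0 < C ∧ ∀ (f : ℂ → ℂ) (c : ℂ) (Λ : ℝ)
    (S : Finset ℂ), Differentiable ℂ f → f c ≠ 0 → 0 < Λ →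
    (∀ z ∈ closedBall c (31 / 16), ‖f z‖ ≤ Real.exp Λ * ‖f c‖) →
    (∀ ρ, ρ ∈ S ↔ f ρ = 0 ∧ ρ ∈ closedBall c (7 / 4)) →
    ∀ s ∈ closedBall c (3 / 2), f s ≠ 0 →
      ‖logDeriv f s - ∑ ρ ∈ S, (analyticOrderNatAt f ρ : ℂ) / (s - ρ)‖ ≤ C * Λ := by
  have hl : 0 < Real.log ((31 / 16) / (7 / 4)) := Real.log_pos (by norm_num)
  refine ⟨208 * (1 + Real.log 16 / Real.log ((31 / 16) / (7 / 4))), ?_, ?_⟩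
  · have : 0 < Real.log 16 := Real.log_pos (by norm_num)
    positivity
  intro f c Λ S hf hc hΛ hb hS s hs hfs
  have htop : ∀ ρ, analyticOrderAt f ρ ≠ ⊤ := by
    intro ρ h
    have := AnalyticOnNhd.analyticOrderAt_ne_top_of_isPreconnected (U := univ)
      (fun z _ => hf.analyticAt z) isPreconnected_univ (mem_univ c) (mem_univ ρ)
      (by rw [(hf.analyticAt c).analyticOrderAt_eq_zero.mpr hc]; exact ENat.zero_ne_top)
    exact this h
  obtain ⟨g, hg, hgS, hfg⟩ := exists_entire_factor hf htop S
  set m : ℂ → ℕ := analyticOrderNatAt f with hm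
  set n : ℕ := ∑ ρ ∈ S, m ρ with hn
  have hcount : (n : ℝ) ≤ Λ / Real.log ((31 / 16) / (7 / 4)) := by
    have := sum_analyticOrderNatAt_le hf hc (r := 7 / 4) (R := 31 / 16) (by norm_num)
      (by norm_num) hΛ.le hb S (fun ρ hρ => ((hS ρ).mp hρ).2)
    rw [hn]; push_cast; exact this
  set P : ℂ → ℂ := fun s => ∏ ρ ∈ S, (s - ρ) ^ m ρ with hP
  have hgc : g c ≠ 0 := fun h => hc (by rw [hfg, h, mul_zero])
  have hPc : ‖P c‖ ≤ 2 ^ n := by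
    rw [hP, hn, ← Finset.prod_pow_eq_pow_sum, norm_prod]
    refine Finset.prod_le_prod (fun _ _ => norm_nonneg _) fun ρ hρ => ?_
    rw [norm_pow]
    have := ((hS ρ).mp hρ).2
    rw [mem_closedBall', dist_eq_norm] at this
    gcongr
    linarith
  have hPs : ∀ z ∈ sphere c (15 / 8 : ℝ), (1 / 8) ^ n ≤ ‖P z‖ := by
    intro z hz
    rw [hP, hn, ← Finset.prod_pow_eq_pow_sum, norm_prod]
    refine Finset.prod_le_prod (fun _ _ => by positivity) fun ρ hρ => ?_
    rw [norm_pow]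
    have h1 := ((hS ρ).mp hρ).2
    rw [mem_closedBall] at h1
    rw [mem_sphere] at hz
    have h2 : 1 / 8 ≤ ‖z - ρ‖ := by
      rw [← dist_eq_norm]; linarith [dist_triangle z ρ c]
    gcongr
  have hgb : ∀ z ∈ closedBall c (15 / 8 : ℝ), ‖g z‖ ≤ Real.exp Λ * 16 ^ n * ‖g c‖ := by
    have hfr : ∀ z ∈ sphere c (15 / 8 : ℝ), ‖g z‖ ≤ Real.exp Λ * 16 ^ n * ‖g c‖ := by
      intro z hz
      have h1 := hb z (by rw [mem_sphere] at hz; rw [mem_closedBall]; linarith)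
      rw [hfg z, hfg c, norm_mul, norm_mul] at h1
      have h2 := hPs z hz
      have h3 : (1 / 8 : ℝ) ^ n * ‖g z‖ ≤ Real.exp Λ * (2 ^ n * ‖g c‖) := by
        calc _ ≤ ‖P z‖ * ‖g z‖ := by gcongr
          _ ≤ Real.exp Λ * (‖P c‖ * ‖g c‖) := h1
          _ ≤ _ := by gcongr
      have h8 : (8 : ℝ) ^ n * (1 / 8) ^ n = 1 := by rw [← mul_pow]; norm_num
      calc ‖g z‖ = 8 ^ n * ((1 / 8) ^ n * ‖g z‖) := by rw [← mul_assoc, h8, one_mul]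
        _ ≤ 8 ^ n * (Real.exp Λ * (2 ^ n * ‖g c‖)) := by gcongr
        _ = Real.exp Λ * (8 ^ n * 2 ^ n) * ‖g c‖ := by ring
        _ = _ := by rw [← mul_pow]; norm_num
    intro z hz
    refine Complex.norm_le_of_forall_mem_frontier_norm_le (U := ball c (15 / 8)) isBounded_ball
      hg.diffContOnCl ?_ ?_
    · rwa [frontier_ball _ (by norm_num)]
    · rwa [closure_ball _ (by norm_num)]
  have hgne : ∀ z ∈ ball c (7 / 4 : ℝ), g z ≠ 0 := by
    intro z hz h0
    have hf0 : f z = 0 := by rw [hfg, h0, mul_zero]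
    exact hgS z ((hS z).mpr ⟨hf0, ball_subset_closedBall hz⟩) h0
  have h16 : Real.exp Λ * 16 ^ n = Real.exp (Λ + n * Real.log 16) := by
    rw [Real.exp_add, mul_comm (n : ℝ), Real.exp_mul, Real.exp_log (by norm_num),
      Real.rpow_natCast]
  have hlg := norm_logDeriv_le_of_ne_zero hg (c := c) (Λ := Λ + n * Real.log 16) (s := s)
    (by have : 0 < Real.log 16 := Real.log_pos (by norm_num)
        positivity) hgne
    (fun z hz => by
      rw [← h16]
      exact hgb z (ball_subset_closedBall.trans (closedBall_subset_closedBall (by norm_num)) hz)) hs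
  have hsP : ∀ ρ ∈ S, s - ρ ≠ 0 := fun ρ hρ h => by
    rw [sub_eq_zero.mp h] at hfs
    exact hfs ((hS ρ).mp hρ).1
  have hlog : logDeriv f s = ∑ ρ ∈ S, (m ρ : ℂ) / (s - ρ) + logDeriv g s := by
    have hf' : f = fun z => P z * g z := funext hfg
    have hgs : g s ≠ 0 := fun h => hfs (by rw [hfg, h, mul_zero])
    have hPd : DifferentiableAt ℂ P s := by
      rw [hP]; fun_prop
    conv_lhs => rw [hf']
    rw [logDeriv_mul s (Finset.prod_ne_zero_iff.mpr fun ρ hρ => pow_ne_zero _ (hsP ρ hρ)) hgs hPd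
      (hg s), hP, logDeriv_prod (f := fun ρ z => (z - ρ) ^ m ρ) (fun ρ hρ => pow_ne_zero _ (hsP ρ hρ)) (fun ρ _ => by fun_prop)]
    congr 1
    refine Finset.sum_congr rfl fun ρ _ => ?_
    rw [logDeriv_fun_pow (f := fun z => z - ρ) (by fun_prop), logDeriv_apply]
    simp [div_eq_mul_inv]
  rw [hlog, add_sub_cancel_left]
  refine hlg.trans ?_
  have : 0 ≤ Real.log 16 := Real.log_nonneg (by norm_num)
  calc 208 * (Λ + n * Real.log 16)
      ≤ 208 * (Λ + Λ / Real.log ((31 / 16) / (7 / 4)) * Real.log 16) := by gcongr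
    _ = _ := by ring

/-- The logarithmic weight `log (|t| + 2)`. -/
noncomputable def logWeight (t : ℝ) : ℝ := Real.log (|t| + 2)

lemma half_le_logWeight (t : ℝ) : 1 / 2 ≤ logWeight t := by
  have h1 : Real.log 2 ≤ logWeight t := Real.log_le_log (by norm_num) (by linarith [abs_nonneg t])
  linarith [Real.log_two_gt_d9]

lemma log_add_two_le_sqrt {u : ℝ} (hu : 0 ≤ u) : Real.log (u + 2) ≤ 2 * √(1 + u) := by
  have h0 : 0 < √(1 + u) := Real.sqrt_pos.mpr (by linarith)
  have h1 := Real.log_le_sub_one_of_pos h0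
  rw [Real.log_sqrt (by linarith)] at h1
  have h2 : Real.log (u + 2) ≤ Real.log (2 * (1 + u)) := Real.log_le_log (by linarith) (by linarith)
  rw [Real.log_mul (by norm_num) (by linarith)] at h2
  linarith [Real.log_two_lt_d9]

lemma logWeight_le_mul (s t : ℝ) : logWeight s ≤ 5 * logWeight t * √(1 + |s - t|) := by
  have h0 := abs_nonneg (s - t)
  have h1 : logWeight s ≤ logWeight t + Real.log (|s - t| + 2) := by
    unfold logWeight
    rw [← Real.log_mul (by positivity) (by positivity)]
    refine Real.log_le_log (by positivity) ?_
    have := abs_sub_abs_le_abs_sub s t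
    nlinarith [abs_nonneg t]
  have h2 := log_add_two_le_sqrt h0
  have h3 := half_le_logWeight t
  have h4 : 1 ≤ √(1 + |s - t|) := Real.one_le_sqrt.mpr (by linarith)
  nlinarith

lemma summable_one_add_abs_rpow : Summable fun j : ℤ => (1 + |(j : ℝ)|) ^ (-(3 / 2) : ℝ) := by
  refine Summable.of_norm_bounded_eventually (Real.summable_abs_int_rpow (b := 3 / 2) (by norm_num)) ?_
  have : ({0}ᶜ : Set ℤ) ∈ (cofinite : Filter ℤ) := (finite_singleton 0).compl_mem_cofinite
  filter_upwards [this] with j hj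
  have hj' : 0 < |(j : ℝ)| := abs_pos.mpr (by exact_mod_cast hj)
  rw [Real.norm_of_nonneg (by positivity)]
  exact Real.rpow_le_rpow_of_nonpos hj' (by linarith) (by norm_num)

lemma exists_sum_logWeight_div_le : ∃ C : ℝ, 0 < C ∧ ∀ (t : ℝ) (F : Finset ℤ),
    ∑ k ∈ F, logWeight k * (1 / (1 + (t - k) ^ 2)) ≤ C * logWeight t := by
  set B := ∑' j : ℤ, (1 + |(j : ℝ)|) ^ (-(3 / 2) : ℝ) with hB
  have hB0 : 0 ≤ B := tsum_nonneg fun j => by positivity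
  refine ⟨40 * (B + 1), by positivity, fun t F => ?_⟩
  have hterm : ∀ k : ℤ, logWeight k * (1 / (1 + (t - k) ^ 2)) ≤
      40 * logWeight t * (1 + |((k - ⌊t⌋ : ℤ) : ℝ)|) ^ (-(3 / 2) : ℝ) := by
    intro k
    set u := |(k : ℝ) - t| with hu
    have hu0 : 0 ≤ u := abs_nonneg _
    have h1 := logWeight_le_mul k t
    have hsq : (t - k) ^ 2 = u ^ 2 := by rw [hu, sq_abs]; ring
    have h2 : (1 + u) ^ 2 / 2 ≤ 1 + (t - k) ^ 2 := by rw [hsq]; nlinarith [sq_nonneg (u - 1)]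
    have h3 : (1 + |((k - ⌊t⌋ : ℤ) : ℝ)|) / 2 ≤ 1 + u := by
      have : |((k - ⌊t⌋ : ℤ) : ℝ)| ≤ u + 1 := by
        push_cast
        calc |(k : ℝ) - ⌊t⌋| = |(k - t) + (t - ⌊t⌋)| := by ring_nf
          _ ≤ _ := (abs_add_le _ _).trans (by
            have h5 : |t - ⌊t⌋| ≤ 1 := by
              rw [abs_le]; constructor <;> linarith [Int.floor_le t, Int.lt_floor_add_one t]
            linarith)
      linarith
    have hl := half_le_logWeight t
    have h4 : √(1 + u) * (1 / ((1 + u) ^ 2 / 2)) = 2 * (1 + u) ^ (-(3 / 2) : ℝ) := by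
      rw [Real.sqrt_eq_rpow, show (-(3 / 2) : ℝ) = 1 / 2 - 2 by norm_num,
        Real.rpow_sub (by positivity), show (1 + u) ^ (2 : ℝ) = (1 + u) ^ 2 by
          exact_mod_cast Real.rpow_natCast (1 + u) 2]
      field_simp
    have h5 : (1 + u) ^ (-(3 / 2) : ℝ) ≤ 4 * (1 + |((k - ⌊t⌋ : ℤ) : ℝ)|) ^ (-(3 / 2) : ℝ) := by
      refine (Real.rpow_le_rpow_of_nonpos (by positivity) h3 (by norm_num)).trans ?_
      rw [Real.div_rpow (by positivity) (by norm_num), div_eq_mul_inv, mul_comm]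
      gcongr
      rw [← Real.rpow_neg (by norm_num), neg_neg]
      calc (2 : ℝ) ^ (3 / 2 : ℝ) ≤ 2 ^ (2 : ℝ) :=
            Real.rpow_le_rpow_of_exponent_le (by norm_num) (by norm_num)
        _ = 4 := by norm_num
    calc _ ≤ (5 * logWeight t * √(1 + u)) * (1 / ((1 + u) ^ 2 / 2)) := by gcongr
      _ = 10 * logWeight t * (1 + u) ^ (-(3 / 2) : ℝ) := by
        rw [mul_assoc, h4]; ring
      _ ≤ 10 * logWeight t * (4 * (1 + |((k - ⌊t⌋ : ℤ) : ℝ)|) ^ (-(3 / 2) : ℝ)) := by gcongr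
      _ = _ := by ring
  have hl := half_le_logWeight t
  calc _ ≤ ∑ k ∈ F, 40 * logWeight t * (1 + |((k - ⌊t⌋ : ℤ) : ℝ)|) ^ (-(3 / 2) : ℝ) :=
        Finset.sum_le_sum fun k _ => hterm k
    _ = 40 * logWeight t * ∑ k ∈ F, (1 + |((k - ⌊t⌋ : ℤ) : ℝ)|) ^ (-(3 / 2) : ℝ) := by
        rw [Finset.mul_sum]
    _ = 40 * logWeight t * ∑ j ∈ F.image (fun k => k - ⌊t⌋), (1 + |(j : ℝ)|) ^ (-(3 / 2) : ℝ) := by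
        rw [Finset.sum_image fun a _ b _ h => by simpa using h]
    _ ≤ 40 * logWeight t * (B + 1) := by
        gcongr
        exact (summable_one_add_abs_rpow.sum_le_tsum _ fun j _ => by positivity).trans
          (by linarith)
    _ = _ := by ring

/-- The multiplicity of a zero of `(s - 1) ζ(s)`. -/
noncomputable def zeroMult (ρ : ℂ) : ℕ := analyticOrderNatAt zetaEntire ρ

lemma analyticOrderAt_zetaEntire_ne_top (ρ : ℂ) : analyticOrderAt zetaEntire ρ ≠ ⊤ :=
  AnalyticOnNhd.analyticOrderAt_ne_top_of_isPreconnected (U := univ)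
    (fun z _ => differentiable_zetaEntire.analyticAt z) isPreconnected_univ (mem_univ 1)
    (mem_univ ρ) (by
      rw [(differentiable_zetaEntire.analyticAt 1).analyticOrderAt_eq_zero.mpr
        (by rw [zetaEntire_one]; exact one_ne_zero)]
      exact ENat.zero_ne_top)

lemma finite_zeros_zetaEntire {K : Set ℂ} (hK : IsCompact K) :
    {ρ | zetaEntire ρ = 0 ∧ ρ ∈ K}.Finite := by
  have hFa : AnalyticOnNhd ℂ zetaEntire K := fun z _ => differentiable_zetaEntire.analyticAt z
  refine ((MeromorphicOn.divisor zetaEntire K).finiteSupport hK).subset fun ρ hρ => ?_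
  rw [Function.mem_support, MeromorphicOn.AnalyticOnNhd.divisor_apply hFa hρ.2]
  have h1 := analyticOrderAt_zetaEntire_ne_top ρ
  have h2 : analyticOrderAt zetaEntire ρ ≠ 0 :=
    (differentiable_zetaEntire.analyticAt ρ).analyticOrderAt_ne_zero.mpr hρ.1
  lift analyticOrderAt zetaEntire ρ to ℕ using h1 with n
  simpa using h2

lemma finite_zetaZeroSet (N : ℝ) :
    {ρ : ℂ | zetaEntire ρ = 0 ∧ ρ ∈ Icc (1 / 4 : ℝ) 1 ×ℂ Icc (-N) N}.Finite :=
  finite_zeros_zetaEntire (isCompact_Icc.reProdIm isCompact_Icc)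

/-- The zeros of `(s - 1) ζ(s)` with `1 / 4 ≤ Re s` and `|Im s| ≤ N`. -/
noncomputable def zetaZeroFinset (N : ℝ) : Finset ℂ := (finite_zetaZeroSet N).toFinset

lemma mem_zetaZeroFinset {N : ℝ} {ρ : ℂ} :
    ρ ∈ zetaZeroFinset N ↔ zetaEntire ρ = 0 ∧ 1 / 4 ≤ ρ.re ∧ ρ.re ≤ 1 ∧ |ρ.im| ≤ N := by
  simp [zetaZeroFinset, Complex.mem_reProdIm, abs_le, and_assoc]

lemma exists_norm_zetaEntire_le_exp : ∃ A : ℝ, 0 < A ∧ ∀ c : ℂ, c.re = 2 →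
    ∀ z ∈ closedBall c (31 / 16), ‖zetaEntire z‖ ≤ Real.exp (A * logWeight c.im) * ‖zetaEntire c‖ := by
  obtain ⟨c₀, hc₀, hlow⟩ := exists_le_norm_zetaEntire
  refine ⟨2 + 2 * |Real.log (1088 / c₀)|, by positivity, fun c hc z hz => ?_⟩
  rw [mem_closedBall, dist_eq_norm] at hz
  have hre := (Complex.abs_re_le_norm (z - c)).trans hz
  have him := (Complex.abs_im_le_norm (z - c)).trans hz
  rw [sub_re, hc, abs_le] at hre
  rw [sub_im] at him
  have h1 := norm_zetaEntire_le (s := z) (by linarith) (by linarith)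
  have h2 : |z.im| ≤ |c.im| + 2 := by linarith [abs_sub_abs_le_abs_sub z.im c.im]
  have h3 : ‖zetaEntire z‖ ≤ 1088 * (|c.im| + 2) ^ 2 := by
    refine h1.trans ?_
    have := abs_nonneg c.im
    have : |z.im| + 2 ≤ 2 * (|c.im| + 2) := by linarith
    calc _ ≤ 272 * (2 * (|c.im| + 2)) ^ 2 := by gcongr
      _ = _ := by ring
  have h4 : Real.exp (2 * logWeight c.im) = (|c.im| + 2) ^ 2 := by
    rw [logWeight, mul_comm, Real.exp_mul, Real.exp_log (by positivity)]
    exact_mod_cast Real.rpow_natCast _ 2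
  have h5 : 1088 / c₀ ≤ Real.exp (2 * |Real.log (1088 / c₀)| * logWeight c.im) := by
    rw [← Real.log_le_iff_le_exp (by positivity)]
    have h := half_le_logWeight c.im
    have h' := le_abs_self (Real.log (1088 / c₀))
    nlinarith [abs_nonneg (Real.log (1088 / c₀))]
  rw [add_mul, Real.exp_add, h4]
  calc _ ≤ 1088 * (|c.im| + 2) ^ 2 := h3
    _ = (|c.im| + 2) ^ 2 * (1088 / c₀) * c₀ := by field_simp
    _ ≤ _ := by gcongr; exact hlow c hc

lemma exists_sum_zeroMult_window_le : ∃ A : ℝ, 0 < A ∧ ∀ (τ : ℝ) (S : Finset ℂ),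
    (∀ ρ ∈ S, 1 / 4 ≤ ρ.re ∧ ρ.re ≤ 1 ∧ |ρ.im - τ| ≤ 1 / 2) →
    ∑ ρ ∈ S, (zeroMult ρ : ℝ) ≤ A * logWeight τ := by
  obtain ⟨A, hA, hb⟩ := exists_norm_zetaEntire_le_exp
  have hl : 0 < Real.log ((31 / 16) / (15 / 8)) := Real.log_pos (by norm_num)
  refine ⟨A / Real.log ((31 / 16) / (15 / 8)), by positivity, fun τ S hS => ?_⟩
  have hl' := half_le_logWeight τ
  have := sum_analyticOrderNatAt_le differentiable_zetaEntire (c := ⟨2, τ⟩) (r := 15 / 8)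
    (R := 31 / 16) (Λ := A * logWeight τ)
    (zetaEntire_ne_zero_of_one_le_re (by norm_num)) (by norm_num) (by norm_num) (by positivity)
    (hb ⟨2, τ⟩ rfl) S fun ρ hρ => ?_
  · refine this.trans (le_of_eq ?_)
    ring
  · obtain ⟨h1, h2, h3⟩ := hS ρ hρ
    rw [mem_closedBall, dist_eq_norm, Complex.norm_def]
    refine Real.sqrt_le_iff.mpr ⟨by norm_num, ?_⟩
    rw [Complex.normSq_apply]
    simp only [sub_re, sub_im]
    rw [abs_le] at h3
    nlinarith

/-- Sums over zeros are controlled by sums over integers. -/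
lemma exists_sum_zeroMult_mul_le : ∃ A : ℝ, 0 < A ∧ ∀ (S : Finset ℂ) (w : ℤ → ℝ) (B : ℝ),
    (∀ ρ ∈ S, 1 / 4 ≤ ρ.re ∧ ρ.re ≤ 1) → (∀ k, 0 ≤ w k) →
    (∀ F : Finset ℤ, ∑ k ∈ F, logWeight k * w k ≤ B) →
    ∑ ρ ∈ S, (zeroMult ρ : ℝ) * w (round ρ.im) ≤ A * B := by
  classical
  obtain ⟨A, hA, hcount⟩ := exists_sum_zeroMult_window_le
  refine ⟨A, hA, fun S w B hS hw hB => ?_⟩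
  rw [← Finset.sum_fiberwise_of_maps_to (g := fun ρ : ℂ => round ρ.im)
    (t := S.image fun ρ => round ρ.im) fun ρ hρ => Finset.mem_image_of_mem _ hρ]
  calc _ ≤ ∑ k ∈ S.image (fun ρ : ℂ => round ρ.im), A * (logWeight k * w k) := by
        refine Finset.sum_le_sum fun k _ => ?_
        have : ∑ ρ ∈ S with round ρ.im = k, (zeroMult ρ : ℝ) * w (round ρ.im) =
            (∑ ρ ∈ S with round ρ.im = k, (zeroMult ρ : ℝ)) * w k := by
          rw [Finset.sum_mul]
          refine Finset.sum_congr rfl fun ρ hρ => ?_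
          rw [(Finset.mem_filter.mp hρ).2]
        rw [this, ← mul_assoc]
        refine mul_le_mul_of_nonneg_right (hcount k _ fun ρ hρ => ?_) (hw k)
        obtain ⟨h1, h2⟩ := Finset.mem_filter.mp hρ
        refine ⟨(hS ρ h1).1, (hS ρ h1).2, ?_⟩
        rw [← h2]
        exact abs_sub_round ρ.im
    _ = A * ∑ k ∈ S.image (fun ρ : ℂ => round ρ.im), logWeight k * w k := by
        rw [Finset.mul_sum]
    _ ≤ _ := by gcongr; exact hB _

lemma exists_sum_zeroMult_kernel_le : ∃ A : ℝ, 0 < A ∧ ∀ (S : Finset ℂ) (t : ℝ),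
    (∀ ρ ∈ S, 1 / 4 ≤ ρ.re ∧ ρ.re ≤ 1) →
    ∑ ρ ∈ S, (zeroMult ρ : ℝ) * (1 / (1 + (t - ρ.im) ^ 2)) ≤ A * logWeight t := by
  obtain ⟨A, hA, h⟩ := exists_sum_zeroMult_mul_le
  obtain ⟨C, hC, hs⟩ := exists_sum_logWeight_div_le
  refine ⟨2 * (A * C), by positivity, fun S t hS => ?_⟩
  have := h S (fun k => 1 / (1 + (t - k) ^ 2)) (C * logWeight t) hS (fun k => by positivity)
    (hs t)
  calc _ ≤ ∑ ρ ∈ S, 2 * ((zeroMult ρ : ℝ) * (1 / (1 + (t - round ρ.im) ^ 2))) := by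
        refine Finset.sum_le_sum fun ρ _ => ?_
        have h1 : 1 / (1 + (t - ρ.im) ^ 2) ≤ 2 * (1 / (1 + (t - round ρ.im) ^ 2)) := by
          rw [mul_one_div, div_le_div_iff₀ (by positivity) (by positivity)]
          have := abs_le.mp (abs_sub_round ρ.im)
          nlinarith [sq_nonneg (t - ρ.im - (ρ.im - round ρ.im)),
            mul_nonneg (sub_nonneg.mpr this.1) (sub_nonneg.mpr this.2)]
        calc _ ≤ (zeroMult ρ : ℝ) * (2 * (1 / (1 + (t - round ρ.im) ^ 2))) := by gcongr
          _ = _ := by ring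
    _ = 2 * ∑ ρ ∈ S, ((zeroMult ρ : ℝ) * (1 / (1 + (t - round ρ.im) ^ 2))) := by
        rw [Finset.mul_sum]
    _ ≤ 2 * (A * (C * logWeight t)) := by gcongr
    _ = _ := by ring

/-- The logarithmic derivative of `(s - 1) ζ(s)` with the polar parts at the points of `S`
removed. -/
noncomputable def regularizedLogDeriv (S : Finset ℂ) (s : ℂ) : ℂ :=
  logDeriv zetaEntire s - ∑ ρ ∈ S, (zeroMult ρ : ℂ) * (1 / (s - ρ) - 1 / (s - (ρ - 3)))

lemma norm_inv_sub_add_three_le {s ρ : ℂ} (hs : 1 / 2 ≤ s.re) (hρ : ρ.re ≤ 1) :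
    ‖1 / (s - (ρ - 3))‖ ≤ 1 := by
  have h1 : 1 ≤ ‖s - (ρ - 3)‖ := by
    refine le_trans ?_ ((le_abs_self _).trans (Complex.abs_re_le_norm _))
    simp only [sub_re, re_ofNat]
    linarith
  rw [norm_div, norm_one]
  exact (div_le_one (by linarith)).mpr h1

lemma norm_inv_sub_sub_inv_le {s ρ : ℂ} {δ : ℝ} (hδ : 0 < δ) (hδ1 : δ ≤ 1) (hs : 1 / 2 ≤ s.re)
    (hρ : ρ.re ≤ 1) (h : δ ≤ ‖s - ρ‖) :
    ‖1 / (s - ρ) - 1 / (s - (ρ - 3))‖ ≤ 6 / δ * (1 / (1 + (s.im - ρ.im) ^ 2)) := by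
  have hb : 1 ≤ ‖s - (ρ - 3)‖ := by
    refine le_trans ?_ ((le_abs_self _).trans (Complex.abs_re_le_norm _))
    simp only [sub_re, re_ofNat]
    linarith
  have ha' : |s.im - ρ.im| ≤ ‖s - ρ‖ := by simpa using Complex.abs_im_le_norm (s - ρ)
  have hb' : |s.im - ρ.im| ≤ ‖s - (ρ - 3)‖ := by
    simpa using Complex.abs_im_le_norm (s - (ρ - 3))
  have h1 : s - ρ ≠ 0 := norm_pos_iff.mp (hδ.trans_le h)
  have h2 : s - (ρ - 3) ≠ 0 := norm_pos_iff.mp (one_pos.trans_le hb)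
  have heq : 1 / (s - ρ) - 1 / (s - (ρ - 3)) = 3 / ((s - ρ) * (s - (ρ - 3))) := by
    field_simp
    ring
  rw [heq, norm_div, norm_mul, ← sq_abs (s.im - ρ.im)]
  set d := |s.im - ρ.im|
  have hd : 0 ≤ d := abs_nonneg _
  have key : δ * (1 + d ^ 2) / 2 ≤ ‖s - ρ‖ * ‖s - (ρ - 3)‖ := by
    rcases le_total d 1 with hd1 | hd1
    · have : δ * 1 ≤ ‖s - ρ‖ * ‖s - (ρ - 3)‖ := by gcongr
      nlinarith
    · have : d * d ≤ ‖s - ρ‖ * ‖s - (ρ - 3)‖ := by gcongr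
      nlinarith
  have hpos : 0 < δ * (1 + d ^ 2) / 2 := by positivity
  calc ‖(3 : ℂ)‖ / (‖s - ρ‖ * ‖s - (ρ - 3)‖) ≤ 3 / (δ * (1 + d ^ 2) / 2) := by
        have : ‖(3 : ℂ)‖ = 3 := by simp
        rw [this]
        gcongr
    _ = _ := by field_simp; norm_num

/-- The zeros of `(s - 1) ζ(s)` close to the point `2 + it`. -/
noncomputable def localZeroFinset (t : ℝ) : Finset ℂ :=
  (finite_zeros_zetaEntire (isCompact_closedBall (⟨2, t⟩ : ℂ) (7 / 4))).toFinset

lemma mem_localZeroFinset {t : ℝ} {ρ : ℂ} :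
    ρ ∈ localZeroFinset t ↔ zetaEntire ρ = 0 ∧ ρ ∈ closedBall (⟨2, t⟩ : ℂ) (7 / 4) := by
  simp [localZeroFinset]

lemma bounds_of_mem_localZeroFinset {t : ℝ} {ρ : ℂ} (h : ρ ∈ localZeroFinset t) :
    1 / 4 ≤ ρ.re ∧ ρ.re ≤ 1 ∧ |t - ρ.im| ≤ 7 / 4 := by
  obtain ⟨h0, h1⟩ := mem_localZeroFinset.mp h
  rw [mem_closedBall, dist_eq_norm] at h1
  have hre := (Complex.abs_re_le_norm _).trans h1
  have him := (Complex.abs_im_le_norm _).trans h1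
  simp only [sub_re, sub_im] at hre him
  refine ⟨by linarith [(abs_le.mp hre).1], ?_, by rwa [abs_sub_comm]⟩
  by_contra hc
  exact zetaEntire_ne_zero_of_one_le_re (not_le.mp hc).le h0

lemma one_le_kernel_of_mem_localZeroFinset {t : ℝ} {ρ : ℂ} (h : ρ ∈ localZeroFinset t) :
    1 ≤ 5 * (1 / (1 + (t - ρ.im) ^ 2)) := by
  have := abs_le.mp (bounds_of_mem_localZeroFinset h).2.2
  rw [mul_one_div, one_le_div (by positivity)]
  nlinarith

lemma exists_norm_logDeriv_zetaEntire_sub_le : ∃ C : ℝ, 0 < C ∧ ∀ s : ℂ, 1 / 2 ≤ s.re →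
    s.re ≤ 2 → zetaEntire s ≠ 0 →
    ‖logDeriv zetaEntire s - ∑ ρ ∈ localZeroFinset s.im, (zeroMult ρ : ℂ) * (1 / (s - ρ))‖ ≤
      C * logWeight s.im := by
  obtain ⟨A, hA, hb⟩ := exists_norm_zetaEntire_le_exp
  obtain ⟨C, hC, h⟩ := exists_norm_logDeriv_sub_sum_le
  refine ⟨C * A, by positivity, fun s h1 h2 hs => ?_⟩
  have hl := half_le_logWeight s.im
  have := h zetaEntire ⟨2, s.im⟩ (A * logWeight s.im) (localZeroFinset s.im)
    differentiable_zetaEntire (zetaEntire_ne_zero_of_one_le_re (by norm_num)) (by positivity)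
    (hb ⟨2, s.im⟩ rfl) (fun ρ => mem_localZeroFinset) s ?_ hs
  · simpa only [zeroMult, mul_one_div, mul_assoc] using this
  · rw [mem_closedBall, dist_eq_norm]
    have : s - ⟨2, s.im⟩ = ((s.re - 2 : ℝ) : ℂ) := by
      apply Complex.ext <;> simp
    rw [this, Complex.norm_real, Real.norm_eq_abs, abs_le]
    constructor <;> linarith

lemma norm_sum_zeroMult_mul_le {S : Finset ℂ} {F : ℂ → ℂ} {w : ℂ → ℝ}
    (h : ∀ ρ ∈ S, ‖F ρ‖ ≤ w ρ) :
    ‖∑ ρ ∈ S, (zeroMult ρ : ℂ) * F ρ‖ ≤ ∑ ρ ∈ S, (zeroMult ρ : ℝ) * w ρ := by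
  refine (norm_sum_le _ _).trans (Finset.sum_le_sum fun ρ hρ => ?_)
  rw [norm_mul, Complex.norm_natCast]
  gcongr
  exact h ρ hρ

/-- Away from the truncation height the regularized logarithmic derivative is `O(log)`. -/
lemma exists_norm_regularizedLogDeriv_le : ∃ C : ℝ, 0 < C ∧ ∀ (N : ℝ) (s : ℂ), 1 / 2 ≤ s.re →
    s.re ≤ 2 → zetaEntire s ≠ 0 → |s.im| + 2 ≤ N →
    ‖regularizedLogDeriv (zetaZeroFinset N) s‖ ≤ C * logWeight s.im := by
  classical
  obtain ⟨C, hC, hloc⟩ := exists_norm_logDeriv_zetaEntire_sub_le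
  obtain ⟨A, hA, hsum⟩ := exists_sum_zeroMult_kernel_le
  refine ⟨C + 5 * A + 24 * A, by positivity, fun N s h1 h2 hs hN => ?_⟩
  have hsub : localZeroFinset s.im ⊆ zetaZeroFinset N := fun ρ hρ => by
    obtain ⟨h3, h4, h5⟩ := bounds_of_mem_localZeroFinset hρ
    refine mem_zetaZeroFinset.mpr ⟨(mem_localZeroFinset.mp hρ).1, h3, h4, ?_⟩
    have := abs_sub_abs_le_abs_sub ρ.im s.im
    rw [abs_sub_comm] at this
    linarith
  set T := zetaZeroFinset N \ localZeroFinset s.im with hT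
  have hdecomp : regularizedLogDeriv (zetaZeroFinset N) s =
      (logDeriv zetaEntire s - ∑ ρ ∈ localZeroFinset s.im, (zeroMult ρ : ℂ) * (1 / (s - ρ)))
      + ∑ ρ ∈ localZeroFinset s.im, (zeroMult ρ : ℂ) * (1 / (s - (ρ - 3)))
      - ∑ ρ ∈ T, (zeroMult ρ : ℂ) * (1 / (s - ρ) - 1 / (s - (ρ - 3))) := by
    rw [regularizedLogDeriv, ← Finset.sum_sdiff hsub]
    simp only [mul_sub, Finset.sum_sub_distrib, hT]
    ring
  have hTb : ∀ ρ ∈ T, 1 / 4 ≤ ρ.re ∧ ρ.re ≤ 1 := fun ρ hρ => by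
    have := mem_zetaZeroFinset.mp (Finset.mem_sdiff.mp hρ).1
    exact ⟨this.2.1, this.2.2.1⟩
  have hE2 : ‖∑ ρ ∈ localZeroFinset s.im, (zeroMult ρ : ℂ) * (1 / (s - (ρ - 3)))‖ ≤
      5 * (A * logWeight s.im) := by
    refine (norm_sum_zeroMult_mul_le (w := fun ρ => 5 * (1 / (1 + (s.im - ρ.im) ^ 2)))
      fun ρ hρ => ?_).trans ?_
    · exact (norm_inv_sub_add_three_le h1 (bounds_of_mem_localZeroFinset hρ).2.1).trans
        (one_le_kernel_of_mem_localZeroFinset hρ)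
    · simp only [mul_left_comm _ (5 : ℝ), ← Finset.mul_sum]
      gcongr
      exact hsum _ _ fun ρ hρ => ⟨(bounds_of_mem_localZeroFinset hρ).1,
        (bounds_of_mem_localZeroFinset hρ).2.1⟩
  have hE3 : ‖∑ ρ ∈ T, (zeroMult ρ : ℂ) * (1 / (s - ρ) - 1 / (s - (ρ - 3)))‖ ≤
      24 * (A * logWeight s.im) := by
    refine (norm_sum_zeroMult_mul_le (w := fun ρ => 24 * (1 / (1 + (s.im - ρ.im) ^ 2)))
      fun ρ hρ => ?_).trans ?_
    · have hfar : 1 / 4 ≤ ‖s - ρ‖ := by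
        by_contra hc
        obtain ⟨h3, h4⟩ := Finset.mem_sdiff.mp hρ
        refine h4 (mem_localZeroFinset.mpr ⟨(mem_zetaZeroFinset.mp h3).1, ?_⟩)
        rw [mem_closedBall, dist_eq_norm]
        have : s - ⟨2, s.im⟩ = ((s.re - 2 : ℝ) : ℂ) := by
          apply Complex.ext <;> simp
        have h5 : ‖s - ⟨2, s.im⟩‖ ≤ 3 / 2 := by
          rw [this, Complex.norm_real, Real.norm_eq_abs, abs_le]
          constructor <;> linarith
        calc ‖ρ - ⟨2, s.im⟩‖ = ‖(s - ⟨2, s.im⟩) - (s - ρ)‖ := by congr 1; ring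
          _ ≤ _ := norm_sub_le _ _
          _ ≤ _ := by linarith
      refine (norm_inv_sub_sub_inv_le (by norm_num) (by norm_num) h1 (hTb ρ hρ).2 hfar).trans
        (le_of_eq ?_)
      norm_num
    · simp only [mul_left_comm _ (24 : ℝ), ← Finset.mul_sum]
      gcongr
      exact hsum _ _ hTb
  rw [hdecomp]
  calc _ ≤ C * logWeight s.im + 5 * (A * logWeight s.im) + 24 * (A * logWeight s.im) :=
        (norm_sub_le _ _).trans (add_le_add ((norm_add_le _ _).trans
          (add_le_add (hloc s h1 h2 hs) hE2)) hE3)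
    _ = _ := by ring

/-- A bound for the regularized logarithmic derivative at distance `δ` from the zeros, uniform in
the truncation. -/
lemma exists_norm_regularizedLogDeriv_le_div : ∃ C : ℝ, 0 < C ∧ ∀ (N δ : ℝ) (s : ℂ),
    0 < δ → δ ≤ 1 → 1 / 2 ≤ s.re → s.re ≤ 2 →
    (∀ ρ, zetaEntire ρ = 0 → 0 < ρ.re → ρ.re + δ ≤ s.re) →
    ‖regularizedLogDeriv (zetaZeroFinset N) s‖ ≤ C / δ * logWeight s.im := by
  obtain ⟨C, hC, hloc⟩ := exists_norm_logDeriv_zetaEntire_sub_le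
  obtain ⟨A, hA, hsum⟩ := exists_sum_zeroMult_kernel_le
  refine ⟨C + 5 * A + 6 * A, by positivity, fun N δ s hδ hδ1 h1 h2 hz => ?_⟩
  have hs : zetaEntire s ≠ 0 := fun h => by
    have := hz s h (by linarith)
    linarith
  have hδ' : 1 ≤ 1 / δ := (one_le_div hδ).mpr hδ1
  have hl := half_le_logWeight s.im
  have hdist : ∀ ρ, zetaEntire ρ = 0 → 1 / 4 ≤ ρ.re → δ ≤ ‖s - ρ‖ := fun ρ h0 h3 => by
    refine le_trans ?_ ((le_abs_self _).trans (Complex.abs_re_le_norm _))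
    rw [sub_re]
    linarith [hz ρ h0 (by linarith)]
  have hdecomp : regularizedLogDeriv (zetaZeroFinset N) s =
      (logDeriv zetaEntire s - ∑ ρ ∈ localZeroFinset s.im, (zeroMult ρ : ℂ) * (1 / (s - ρ)))
      + ∑ ρ ∈ localZeroFinset s.im, (zeroMult ρ : ℂ) * (1 / (s - ρ))
      - ∑ ρ ∈ zetaZeroFinset N, (zeroMult ρ : ℂ) * (1 / (s - ρ) - 1 / (s - (ρ - 3))) := by
    rw [regularizedLogDeriv]
    ring
  have hE2 : ‖∑ ρ ∈ localZeroFinset s.im, (zeroMult ρ : ℂ) * (1 / (s - ρ))‖ ≤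
      5 / δ * (A * logWeight s.im) := by
    refine (norm_sum_zeroMult_mul_le (w := fun ρ => 5 / δ * (1 / (1 + (s.im - ρ.im) ^ 2)))
      fun ρ hρ => ?_).trans ?_
    · have h3 := bounds_of_mem_localZeroFinset hρ
      have h4 := one_le_kernel_of_mem_localZeroFinset hρ
      rw [norm_div, norm_one]
      calc 1 / ‖s - ρ‖ ≤ 1 / δ := by
            gcongr
            exact hdist ρ (mem_localZeroFinset.mp hρ).1 h3.1
        _ ≤ 1 / δ * (5 * (1 / (1 + (s.im - ρ.im) ^ 2))) := le_mul_of_one_le_right (by positivity) h4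
        _ = _ := by ring
    · simp only [mul_left_comm _ (5 / δ : ℝ), ← Finset.mul_sum]
      gcongr
      exact hsum _ _ fun ρ hρ => ⟨(bounds_of_mem_localZeroFinset hρ).1,
        (bounds_of_mem_localZeroFinset hρ).2.1⟩
  have hE3 : ‖∑ ρ ∈ zetaZeroFinset N, (zeroMult ρ : ℂ) * (1 / (s - ρ) - 1 / (s - (ρ - 3)))‖ ≤
      6 / δ * (A * logWeight s.im) := by
    refine (norm_sum_zeroMult_mul_le (w := fun ρ => 6 / δ * (1 / (1 + (s.im - ρ.im) ^ 2)))
      fun ρ hρ => ?_).trans ?_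
    · obtain ⟨h3, h4, h5, -⟩ := mem_zetaZeroFinset.mp hρ
      exact norm_inv_sub_sub_inv_le hδ hδ1 h1 h5 (hdist ρ h3 h4)
    · simp only [mul_left_comm _ (6 / δ : ℝ), ← Finset.mul_sum]
      gcongr
      exact hsum _ _ fun ρ hρ => ⟨(mem_zetaZeroFinset.mp hρ).2.1, (mem_zetaZeroFinset.mp hρ).2.2.1⟩
  rw [hdecomp]
  calc _ ≤ C * logWeight s.im + 5 / δ * (A * logWeight s.im) + 6 / δ * (A * logWeight s.im) :=
        (norm_sub_le _ _).trans (add_le_add ((norm_add_le _ _).trans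
          (add_le_add (hloc s h1 h2 hs) hE2)) hE3)
    _ ≤ C * (1 / δ) * logWeight s.im + 5 / δ * (A * logWeight s.im)
        + 6 / δ * (A * logWeight s.im) := by
        gcongr
        exact le_mul_of_one_le_right hC.le hδ'
    _ = _ := by ring

lemma integrable_of_norm_le_rpow {f : ℝ → ℂ} (hf : Continuous f) {B : ℝ}
    (h : ∀ t, ‖f t‖ ≤ B * (1 + |t|) ^ (-(3 / 2) : ℝ)) : Integrable f := by
  have h1 : Integrable fun t : ℝ => (1 + ‖t‖) ^ (-(3 / 2) : ℝ) :=
    integrable_one_add_norm (by simp; norm_num)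
  refine Integrable.mono' (h1.const_mul B) hf.aestronglyMeasurable (Eventually.of_forall fun t => ?_)
  simpa using h t

lemma tendsto_one_add_abs_rpow (B : ℝ) :
    Tendsto (fun T : ℝ => B * (1 + |T|) ^ (-(3 / 2) : ℝ)) atTop (𝓝 0) := by
  have h1 : Tendsto (fun T : ℝ => 1 + |T|) atTop atTop :=
    tendsto_atTop_add_const_left _ _ tendsto_abs_atTop_atTop
  simpa using ((tendsto_rpow_neg_atTop (by norm_num : (0 : ℝ) < 3 / 2)).comp h1).const_mul B

/-- Moving a vertical line of integration. -/
lemma integral_vertical_line_eq {F : ℂ → ℂ} {a b B : ℝ} (hab : a ≤ b)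
    (hF : ∀ s : ℂ, a ≤ s.re → s.re ≤ b → DifferentiableAt ℂ F s)
    (hb : ∀ s : ℂ, a ≤ s.re → s.re ≤ b → ‖F s‖ ≤ B * (1 + |s.im|) ^ (-(3 / 2) : ℝ)) :
    ∫ t : ℝ, F (a + t * I) = ∫ t : ℝ, F (b + t * I) := by
  have hvert : ∀ c : ℝ, a ≤ c → c ≤ b → Integrable fun t : ℝ => F (c + t * I) := by
    intro c hac hcb
    refine integrable_of_norm_le_rpow (B := B) ?_ fun t => ?_
    · refine continuous_iff_continuousAt.mpr fun t => ?_
      exact ContinuousAt.comp (f := fun t : ℝ => (c : ℂ) + t * I)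
        (hF _ (by simpa using hac) (by simpa using hcb)).continuousAt (by fun_prop)
    · simpa using hb (c + t * I) (by simpa using hac) (by simpa using hcb)
  have hlim : ∀ c : ℝ, a ≤ c → c ≤ b →
      Tendsto (fun T : ℝ => ∫ t in (-T)..T, F (c + t * I)) atTop (𝓝 (∫ t : ℝ, F (c + t * I))) :=
    fun c h1 h2 => intervalIntegral_tendsto_integral (hvert c h1 h2) tendsto_neg_atTop_atBot
      tendsto_id
  have hhor : ∀ T : ℝ, ‖∫ x in a..b, F (x + T * I)‖ ≤
      (B * |b - a|) * (1 + |T|) ^ (-(3 / 2) : ℝ) := by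
    intro T
    refine (intervalIntegral.norm_integral_le_of_norm_le_const
      (C := B * (1 + |T|) ^ (-(3 / 2) : ℝ)) fun x hx => ?_).trans (le_of_eq (by ring))
    rw [uIoc_of_le hab] at hx
    simpa using hb (x + T * I) (by simpa using hx.1.le) (by simpa using hx.2)
  have hhor1 : Tendsto (fun T : ℝ => ∫ x in a..b, F (x + T * I)) atTop (𝓝 0) :=
    squeeze_zero_norm hhor (tendsto_one_add_abs_rpow _)
  have hhor2 : Tendsto (fun T : ℝ => ∫ x in a..b, F (x + ((-T : ℝ) : ℂ) * I)) atTop (𝓝 0) :=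
    squeeze_zero_norm (fun T => by simpa using hhor (-T)) (tendsto_one_add_abs_rpow (B * |b - a|))
  have hrect : ∀ T : ℝ, (∫ x in a..b, F (x + ((-T : ℝ) : ℂ) * I)) - (∫ x in a..b, F (x + T * I)) +
      I • (∫ t in (-T)..T, F (b + t * I)) - I • (∫ t in (-T)..T, F (a + t * I)) = 0 := by
    intro T
    have := integral_boundary_rect_eq_zero_of_differentiableOn F ⟨a, -T⟩ ⟨b, T⟩ fun s hs => by
      have h1 := (mem_reProdIm.mp hs).1
      rw [uIcc_of_le (by exact hab)] at h1
      exact (hF s h1.1 h1.2).differentiableWithinAt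
    exact this
  have hzero := ((hhor2.sub hhor1).add ((hlim b hab le_rfl).const_smul I)).sub
    ((hlim a le_rfl hab).const_smul I)
  simp_rw [hrect] at hzero
  have := tendsto_nhds_unique hzero tendsto_const_nhds
  rw [sub_zero, zero_add, ← smul_sub, smul_eq_mul, mul_eq_zero] at this
  exact (sub_eq_zero.mp (this.resolve_left I_ne_zero)).symm

/-- The smoothing kernel `y ^ (s + 1) / (s (s + 1))`. -/
noncomputable def smoothKernel (y : ℝ) (s : ℂ) : ℂ := (y : ℂ) ^ (s + 1) / (s * (s + 1))

lemma norm_inv_mul_add_one_le {s : ℂ} (hs : 1 / 2 ≤ s.re) :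
    ‖1 / (s * (s + 1))‖ ≤ 8 * (1 + |s.im|) ^ (-2 : ℝ) := by
  have h1 : (1 + |s.im|) / 3 ≤ ‖s‖ := by
    have a := Complex.abs_im_le_norm s
    have b := (le_abs_self _).trans (Complex.abs_re_le_norm s)
    linarith
  have h2 : (1 + |s.im|) / 2 ≤ ‖s + 1‖ := by
    have a := Complex.abs_im_le_norm (s + 1)
    have b := (le_abs_self _).trans (Complex.abs_re_le_norm (s + 1))
    simp only [add_im, one_im, add_zero, add_re, one_re] at a b
    linarith
  have h0 := abs_nonneg s.im
  rw [norm_div, norm_one, norm_mul, Real.rpow_neg (by positivity)]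
  calc 1 / (‖s‖ * ‖s + 1‖) ≤ 1 / ((1 + |s.im|) / 3 * ((1 + |s.im|) / 2)) := by gcongr
    _ = 6 * ((1 + |s.im|) ^ (2 : ℝ))⁻¹ := by
      rw [show (1 + |s.im|) ^ (2 : ℝ) = (1 + |s.im|) ^ 2 by exact_mod_cast Real.rpow_natCast _ 2]
      field_simp
      norm_num
    _ ≤ _ := by gcongr; norm_num

lemma logWeight_mul_rpow_le (t : ℝ) :
    logWeight t * (1 + |t|) ^ (-2 : ℝ) ≤ 2 * (1 + |t|) ^ (-(3 / 2) : ℝ) := by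
  have h0 := abs_nonneg t
  have h1 := log_add_two_le_sqrt h0
  calc _ ≤ 2 * √(1 + |t|) * (1 + |t|) ^ (-2 : ℝ) := by gcongr; exact h1
    _ = _ := by
      rw [Real.sqrt_eq_rpow, mul_assoc, ← Real.rpow_add (by positivity)]
      norm_num

lemma rpow_neg_two_le (t : ℝ) : (1 + |t|) ^ (-2 : ℝ) ≤ (1 + |t|) ^ (-(3 / 2) : ℝ) :=
  Real.rpow_le_rpow_of_exponent_le (by linarith [abs_nonneg t]) (by norm_num)

lemma norm_smoothKernel_le {y : ℝ} (hy : 1 ≤ y) {s : ℂ} (h1 : 1 / 2 ≤ s.re) (h2 : s.re ≤ 2) :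
    ‖smoothKernel y s‖ ≤ 8 * y ^ 3 * (1 + |s.im|) ^ (-2 : ℝ) := by
  have hy0 : 0 < y := by linarith
  rw [smoothKernel, div_eq_mul_one_div, norm_mul, Complex.norm_cpow_eq_rpow_re_of_pos hy0]
  have h3 : y ^ (s + 1).re ≤ y ^ 3 := by
    rw [← Real.rpow_natCast]
    refine Real.rpow_le_rpow_of_exponent_le hy ?_
    simp only [add_re, one_re, Nat.cast_ofNat]
    linarith
  calc _ ≤ y ^ 3 * (8 * (1 + |s.im|) ^ (-2 : ℝ)) := by
        gcongr
        exact norm_inv_mul_add_one_le h1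
    _ = _ := by ring

lemma differentiableAt_smoothKernel {y : ℝ} (hy : 0 < y) {s : ℂ} (hs : 0 < s.re) :
    DifferentiableAt ℂ (smoothKernel y) s := by
  have h1 : s ≠ 0 := fun h => by simp [h] at hs
  have h2 : s + 1 ≠ 0 := fun h => by
    have := congrArg Complex.re h
    simp at this
    linarith
  refine DifferentiableAt.div ?_ (by fun_prop) (mul_ne_zero h1 h2)
  exact (differentiableAt_id.add_const 1).const_cpow (Or.inl (by exact_mod_cast hy.ne'))

/-- Mellin inversion in terms of a transform pair. -/
lemma integral_cpow_mul_eq_of_hasMellin {f : ℝ → ℂ} {F : ℂ → ℂ} {x : ℝ} (hx : 0 < x)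
    (hf : ∀ t : ℝ, HasMellin f (2 + t * I) (F (2 + t * I)))
    (hF : Integrable fun t : ℝ => F (2 + t * I)) (hfx : ContinuousAt f x) :
    ∫ t : ℝ, (x : ℂ) ^ (-(2 + t * I)) * F (2 + t * I) = 2 * Real.pi * f x := by
  have h := mellinInv_mellin_eq 2 f hx (by simpa using (hf 0).1) (by
    unfold VerticalIntegrable
    refine hF.congr (Eventually.of_forall fun t => ?_)
    simpa using ((hf t).2).symm) hfx
  rw [← h, mellinInv]
  have : ∀ t : ℝ, mellin f (((2 : ℝ) : ℂ) + t * I) = F (2 + t * I) := fun t => by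
    simpa using (hf t).2
  simp_rw [this]
  have hpi : (Real.pi : ℂ) ≠ 0 := by exact_mod_cast Real.pi_ne_zero
  simp only [smul_eq_mul, Complex.real_smul, ofReal_ofNat]
  generalize ∫ t : ℝ, (x : ℂ) ^ (-(2 + t * I)) * F (2 + t * I) = J
  push_cast
  field_simp

lemma line_re (t : ℝ) : (2 + (t : ℂ) * I).re = 2 := by simp
lemma line_im (t : ℝ) : (2 + (t : ℂ) * I).im = t := by simp

lemma continuous_line {F : ℂ → ℂ} {c : ℝ} (hF : ∀ s : ℂ, s.re = c → DifferentiableAt ℂ F s) :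
    Continuous fun t : ℝ => F (c + t * I) :=
  continuous_iff_continuousAt.mpr fun t => ContinuousAt.comp (f := fun t : ℝ => (c : ℂ) + t * I)
    (hF _ (by simp)).continuousAt (by fun_prop)

lemma continuous_line_two {F : ℂ → ℂ} (hF : ∀ s : ℂ, s.re = 2 → DifferentiableAt ℂ F s) :
    Continuous fun t : ℝ => F (2 + t * I) := by
  simpa using continuous_line (c := 2) hF

/-- The contribution of a simple pole at `a` to the smoothed explicit formula. -/
noncomputable def poleTerm (y : ℝ) (a : ℂ) : ℂ :=
  (y : ℂ) ^ (a + 1) / (a * (a + 1)) - y / a + 1 / (a + 1)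

lemma differentiableAt_inv_sub_mul_smoothKernel {y : ℝ} (hy : 0 < y) {a s : ℂ} (ha : a.re < s.re)
    (hs : 0 < s.re) : DifferentiableAt ℂ (fun s => 1 / (s - a) * smoothKernel y s) s := by
  have h1 : s - a ≠ 0 := fun h => by rw [sub_eq_zero.mp h] at ha; exact lt_irrefl _ ha
  have h2 : DifferentiableAt ℂ (fun z => 1 / (z - a)) s :=
    (differentiableAt_const _).div (by fun_prop) h1
  exact h2.mul (differentiableAt_smoothKernel (s := s) hy hs)

lemma norm_inv_sub_le {a s : ℂ} (ha : a.re < s.re) : ‖1 / (s - a)‖ ≤ 1 / (s.re - a.re) := by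
  rw [norm_div, norm_one]
  refine one_div_le_one_div_of_le (by linarith) ?_
  simpa using (le_abs_self _).trans (Complex.abs_re_le_norm (s - a))

lemma integrable_inv_sub_mul_smoothKernel {y : ℝ} (hy : 1 ≤ y) {a : ℂ} (ha : a.re < 2) :
    Integrable fun t : ℝ => 1 / (2 + t * I - a) * smoothKernel y (2 + t * I) := by
  refine integrable_of_norm_le_rpow (B := 1 / (2 - a.re) * (8 * y ^ 3))
    (continuous_line_two (F := fun s => 1 / (s - a) * smoothKernel y s) fun s hs =>
      differentiableAt_inv_sub_mul_smoothKernel (by linarith) (by linarith) (by linarith)) fun t => ?_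
  have h1 := norm_inv_sub_le (a := a) (s := 2 + t * I) (by simpa using ha)
  have h2 := norm_smoothKernel_le hy (s := 2 + t * I) (by simp; norm_num) (by simp)
  rw [line_re] at h1
  rw [line_im] at h2
  have h3 : 0 < 2 - a.re := by linarith
  rw [norm_mul]
  calc _ ≤ 1 / (2 - a.re) * (8 * y ^ 3 * (1 + |t|) ^ (-2 : ℝ)) := by gcongr
    _ ≤ 1 / (2 - a.re) * (8 * y ^ 3 * (1 + |t|) ^ (-(3 / 2) : ℝ)) := by
        gcongr 1 / (2 - a.re) * (8 * y ^ 3 * ?_)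
        exact rpow_neg_two_le t
    _ = _ := by ring

lemma smoothKernel_eq {y : ℝ} (hy : 0 < y) (s : ℂ) :
    smoothKernel y s = y * ((y⁻¹ : ℝ) : ℂ) ^ (-s) * (1 / (s * (s + 1))) := by
  have hy' : (y : ℂ) ≠ 0 := by exact_mod_cast hy.ne'
  rw [smoothKernel, Complex.cpow_add _ _ hy', Complex.cpow_one, ofReal_inv, Complex.cpow_neg,
    Complex.inv_cpow _ _ (by rw [Complex.arg_ofReal_of_nonneg hy.le]; exact Real.pi_pos.ne),
    inv_inv]
  ring

lemma integral_inv_sub_mul_smoothKernel {y : ℝ} (hy : 1 < y) {a : ℂ} (ha : a.re < 2)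
    (ha0 : a ≠ 0) (ha1 : a + 1 ≠ 0) :
    ∫ t : ℝ, 1 / (2 + t * I - a) * smoothKernel y (2 + t * I) = 2 * Real.pi * poleTerm y a := by
  have hy0 : 0 < y := by linarith
  set f : ℝ → ℂ := (fun u => (1 / (a * (a + 1))) • (indicator (Ioc 0 1) (fun t : ℝ => (t : ℂ) ^ (-a))) u
      + (-1 / a) • (indicator (Ioc 0 1) (fun t : ℝ => (t : ℂ) ^ (0 : ℂ))) u
      + (1 / (a + 1)) • (indicator (Ioc 0 1) (fun t : ℝ => (t : ℂ) ^ (1 : ℂ))) u) with hf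
  set F : ℂ → ℂ := fun s => 1 / (s - a) * (1 / (s * (s + 1))) with hF
  have hmel : ∀ t : ℝ, HasMellin f (2 + t * I) (F (2 + t * I)) := by
    intro t
    set s : ℂ := 2 + t * I with hs
    have hre : s.re = 2 := line_re t
    have m1 := hasMellin_cpow_Ioc (-a) (s := s) (by rw [hre, neg_re]; linarith)
    have m2 := hasMellin_cpow_Ioc 0 (s := s) (by rw [hre]; simp)
    have m3 := hasMellin_cpow_Ioc 1 (s := s) (by rw [hre, one_re]; norm_num)
    have k1 := hasMellin_const_smul m1.1 (1 / (a * (a + 1)))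
    have k2 := hasMellin_const_smul m2.1 (-1 / a)
    have k3 := hasMellin_const_smul m3.1 (1 / (a + 1))
    have k12 := hasMellin_add k1.1 k2.1
    have k := hasMellin_add k12.1 k3.1
    refine ⟨k.1, k.2.trans ?_⟩
    rw [k12.2, k1.2, k2.2, k3.2, m1.2, m2.2, m3.2]
    have e1 : s - a ≠ 0 := fun h => by
      have := congrArg Complex.re h
      rw [sub_re, hre, zero_re] at this
      linarith
    have e2 : s ≠ 0 := fun h => by rw [h, zero_re] at hre; norm_num at hre
    have e3 : s + 1 ≠ 0 := fun h => by
      have := congrArg Complex.re h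
      rw [add_re, hre, zero_re, one_re] at this
      norm_num at this
    simp only [hF, smul_eq_mul, add_zero, ← sub_eq_add_neg]
    field_simp
    ring
  have hFi : Integrable fun t : ℝ => F (2 + t * I) := by
    have := integrable_inv_sub_mul_smoothKernel (y := 1) le_rfl ha
    simpa [smoothKernel, hF] using this
  have hc : ContinuousAt f y⁻¹ := by
    have hmem : Ioo (0 : ℝ) 1 ∈ 𝓝 y⁻¹ := Ioo_mem_nhds (by positivity) (inv_lt_one_of_one_lt₀ hy)
    have : f =ᶠ[𝓝 y⁻¹] fun u => (1 / (a * (a + 1))) • ((u : ℂ) ^ (-a))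
        + (-1 / a) • ((u : ℂ) ^ (0 : ℂ)) + (1 / (a + 1)) • ((u : ℂ) ^ (1 : ℂ)) := by
      filter_upwards [hmem] with u hu
      have : u ∈ Ioc (0 : ℝ) 1 := ⟨hu.1, hu.2.le⟩
      simp only [hf, indicator_of_mem this]
    refine ContinuousAt.congr ?_ this.symm
    have hy' : (y⁻¹ : ℝ) ≠ 0 := by positivity
    have hp (b c : ℂ) : ContinuousAt (fun u : ℝ => c • ((u : ℂ) ^ b)) y⁻¹ :=
      (Complex.continuousAt_ofReal_cpow_const _ _ (Or.inr hy')).const_smul c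
    exact ((hp _ _).add (hp _ _)).add (hp _ _)
  have h := integral_cpow_mul_eq_of_hasMellin (x := y⁻¹) (by positivity) hmel hFi hc
  have hint : ∀ t : ℝ, 1 / (2 + t * I - a) * smoothKernel y (2 + t * I) =
      y * (((y⁻¹ : ℝ) : ℂ) ^ (-(2 + t * I)) * F (2 + t * I)) := fun t => by
    rw [smoothKernel_eq hy0, hF]
    ring
  simp_rw [hint]
  rw [integral_const_mul, h]
  have hmem : y⁻¹ ∈ Ioc (0 : ℝ) 1 := ⟨by positivity, inv_le_one_of_one_le₀ hy.le⟩
  have hyc : (y : ℂ) ≠ 0 := by exact_mod_cast hy0.ne'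
  have hpow : ((y⁻¹ : ℝ) : ℂ) ^ (-a) = (y : ℂ) ^ a := by
    rw [ofReal_inv, Complex.cpow_neg, Complex.inv_cpow _ _
      (by rw [Complex.arg_ofReal_of_nonneg hy0.le]; exact Real.pi_pos.ne), inv_inv]
  simp only [hf, indicator_of_mem hmem, hpow, poleTerm, smul_eq_mul, Complex.cpow_zero,
    Complex.cpow_one, Complex.cpow_add _ _ hyc]
  rw [ofReal_inv]
  field_simp
  ring

lemma hasMellin_max_zero_one_sub {s : ℂ} (hs : 0 < s.re) :
    HasMellin (fun u : ℝ => ((max 0 (1 - u) : ℝ) : ℂ)) s (1 / (s * (s + 1))) := by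
  have m2 := hasMellin_cpow_Ioc 0 (s := s) (by simpa using hs)
  have m3 := hasMellin_cpow_Ioc 1 (s := s) (by rw [one_re]; linarith)
  have k := hasMellin_sub m2.1 m3.1
  have heq : EqOn (fun u : ℝ => (u : ℂ) ^ (s - 1) • (indicator (Ioc 0 1) (fun t : ℝ => (t : ℂ) ^ (0 : ℂ)) u
      - indicator (Ioc 0 1) (fun t : ℝ => (t : ℂ) ^ (1 : ℂ)) u))
      (fun u : ℝ => (u : ℂ) ^ (s - 1) • ((max 0 (1 - u) : ℝ) : ℂ)) (Ioi 0) := by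
    intro u hu
    by_cases h : u ≤ 1
    · have hm : u ∈ Ioc (0 : ℝ) 1 := ⟨hu, h⟩
      simp only [indicator_of_mem hm, Complex.cpow_zero, Complex.cpow_one]
      rw [max_eq_right (by linarith)]
      push_cast
      rfl
    · have hm : u ∉ Ioc (0 : ℝ) 1 := fun hm => h hm.2
      simp only [indicator_of_notMem hm]
      rw [max_eq_left (by linarith)]
      simp
  refine ⟨(integrableOn_congr_fun heq measurableSet_Ioi).mp k.1, ?_⟩
  rw [mellin, ← setIntegral_congr_fun measurableSet_Ioi heq]
  refine k.2.trans ?_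
  rw [m2.2, m3.2]
  have e2 : s ≠ 0 := fun h => by simp [h] at hs
  have e3 : s + 1 ≠ 0 := fun h => by
    have := congrArg Complex.re h
    simp at this
    linarith
  rw [add_zero]
  field_simp
  ring

lemma integrable_smoothKernel {y : ℝ} (hy : 1 ≤ y) :
    Integrable fun t : ℝ => smoothKernel y (2 + t * I) := by
  refine integrable_of_norm_le_rpow (B := 8 * y ^ 3) (continuous_line_two fun s hs =>
    differentiableAt_smoothKernel (by linarith) (by linarith)) fun t => ?_
  have h2 := norm_smoothKernel_le hy (s := 2 + t * I) (by simp; norm_num) (by simp)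
  rw [line_im] at h2
  refine h2.trans ?_
  gcongr 8 * y ^ 3 * ?_
  exact rpow_neg_two_le t

lemma integral_cpow_neg_mul_smoothKernel {y x : ℝ} (hy : 1 ≤ y) (hx : 0 < x) :
    ∫ t : ℝ, (x : ℂ) ^ (-(2 + t * I)) * smoothKernel y (2 + t * I) =
      2 * Real.pi * ((max 0 (y - x) : ℝ) : ℂ) := by
  have hy0 : 0 < y := by linarith
  have h := integral_cpow_mul_eq_of_hasMellin (x := x / y) (F := fun s => 1 / (s * (s + 1)))
    (by positivity) (fun t => hasMellin_max_zero_one_sub (by simp))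
    (by simpa [smoothKernel] using integrable_smoothKernel (y := 1) le_rfl)
    (by fun_prop)
  have hint : ∀ t : ℝ, (x : ℂ) ^ (-(2 + t * I)) * smoothKernel y (2 + t * I) =
      y * (((x / y : ℝ) : ℂ) ^ (-(2 + t * I)) * (1 / ((2 + t * I) * ((2 + t * I) + 1)))) := fun t => by
    rw [smoothKernel_eq hy0, show x / y = x * y⁻¹ from div_eq_mul_inv x y, ofReal_mul,
      Complex.mul_cpow_ofReal_nonneg hx.le (by positivity)]
    ring
  simp_rw [hint]
  rw [integral_const_mul, h]
  have : max 0 (y - x) = y * max 0 (1 - x / y) := by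
    rw [mul_max_of_nonneg _ _ hy0.le, mul_zero, mul_sub, mul_one, mul_div_cancel₀ _ hy0.ne']
  rw [this]
  push_cast
  ring

/-- The smoothed Chebyshev function `∑ Λ(n) (y - n)⁺`. -/
noncomputable def smoothPsi (y : ℝ) : ℝ :=
  ∑' n : ℕ, ArithmeticFunction.vonMangoldt n * max 0 (y - n)

lemma smoothPsi_eq_sum {y : ℝ} {M : ℕ} (h : y < M + 1) :
    smoothPsi y = ∑ n ∈ Finset.Iic M, ArithmeticFunction.vonMangoldt n * max 0 (y - n) := by
  refine tsum_eq_sum fun n hn => ?_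
  have : (M : ℝ) + 1 ≤ n := by
    rw [Finset.mem_Iic, not_le] at hn
    exact_mod_cast hn
  rw [max_eq_left (by linarith), mul_zero]

lemma integral_LSeries_mul_smoothKernel {y : ℝ} (hy : 1 ≤ y) :
    ∫ t : ℝ, LSeries (fun n => (ArithmeticFunction.vonMangoldt n : ℂ)) (2 + t * I) *
      smoothKernel y (2 + t * I) = 2 * Real.pi * (smoothPsi y : ℂ) := by
  set f : ℕ → ℂ := fun n => (ArithmeticFunction.vonMangoldt n : ℂ) with hf
  set F : ℕ → ℝ → ℂ := fun n t => LSeries.term f (2 + t * I) n * smoothKernel y (2 + t * I) with hF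
  have hnorm : ∀ n t, ‖F n t‖ = ‖LSeries.term f 2 n‖ * ‖smoothKernel y (2 + t * I)‖ := by
    intro n t
    rw [hF, norm_mul, LSeries.norm_term_eq, LSeries.norm_term_eq, line_re, Complex.re_ofNat]
  have hcont : ∀ n, Continuous (F n) := by
    intro n
    refine continuous_line_two (F := fun s => LSeries.term f s n * smoothKernel y s) fun s hs => ?_
    refine DifferentiableAt.mul ?_ (differentiableAt_smoothKernel (by linarith) (by linarith))
    rcases eq_or_ne n 0 with rfl | hn
    · simp only [LSeries.term_zero]
      exact differentiableAt_const _
    · simp only [LSeries.term_of_ne_zero hn]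
      have hn' : (n : ℂ) ≠ 0 := by exact_mod_cast hn
      refine (differentiableAt_const _).div ?_ (by simp [Complex.cpow_eq_zero_iff, hn'])
      exact differentiableAt_id.const_cpow (Or.inl hn')
  have hk := integrable_smoothKernel hy
  have hint : ∀ n, Integrable (F n) := fun n =>
    (hk.norm.const_mul ‖LSeries.term f 2 n‖).mono' (hcont n).aestronglyMeasurable
      (Eventually.of_forall fun t => (hnorm n t).le)
  have hsum : Summable fun n => ∫ t, ‖F n t‖ := by
    simp_rw [hnorm, integral_const_mul]
    exact (ArithmeticFunction.LSeriesSummable_vonMangoldt (s := 2) (by simp)).norm.mul_right _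
  have h := hasSum_integral_of_summable_integral_norm hint hsum
  have h2 : ∀ t : ℝ, ∑' n, F n t = LSeries f (2 + t * I) * smoothKernel y (2 + t * I) :=
    fun t => by rw [hF, tsum_mul_right, LSeries]
  simp_rw [h2] at h
  rw [← h.tsum_eq, smoothPsi, ofReal_tsum, ← tsum_mul_left]
  refine tsum_congr fun n => ?_
  rcases eq_or_ne n 0 with rfl | hn
  · simp [hF]
  · have hn' : (0 : ℝ) < n := by exact_mod_cast Nat.pos_of_ne_zero hn
    have h3 : ∀ t : ℝ, F n t = f n * (((n : ℝ) : ℂ) ^ (-(2 + t * I)) * smoothKernel y (2 + t * I)) := by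
      intro t
      rw [hF]
      simp only [LSeries.term_of_ne_zero hn]
      rw [Complex.cpow_neg, ofReal_natCast]
      ring
    simp_rw [h3]
    rw [integral_const_mul, integral_cpow_neg_mul_smoothKernel hy hn', hf]
    push_cast
    ring

lemma LSeries_vonMangoldt_eq_sub {s : ℂ} (hs : 1 < s.re) :
    LSeries (fun n => (ArithmeticFunction.vonMangoldt n : ℂ)) s =
      1 / (s - 1) - logDeriv zetaEntire s := by
  have hs1 : s ≠ 1 := fun h => by rw [h, one_re] at hs; exact lt_irrefl _ hs
  have hs1' : s - 1 ≠ 0 := sub_ne_zero.mpr hs1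
  have hz : riemannZeta s ≠ 0 := riemannZeta_ne_zero_of_one_lt_re hs
  have hL : logDeriv zetaEntire s = logDeriv (fun s => (s - 1) * riemannZeta s) s := by
    rw [logDeriv_apply, logDeriv_apply, (zetaEntire_eventuallyEq hs1).deriv_eq,
      (zetaEntire_eventuallyEq hs1).eq_of_nhds]
  rw [ArithmeticFunction.LSeries_vonMangoldt_eq_deriv_riemannZeta_div hs, hL, logDeriv_mul s hs1' hz (by fun_prop)
    (differentiableAt_riemannZeta hs1)]
  simp [logDeriv_apply]
  ring

lemma differentiableAt_regularizedLogDeriv {S : Finset ℂ} {s : ℂ} (hs : zetaEntire s ≠ 0)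
    (hS : ∀ ρ ∈ S, ρ.re < s.re) : DifferentiableAt ℂ (regularizedLogDeriv S) s := by
  have h1 : DifferentiableAt ℂ (logDeriv zetaEntire) s :=
    ((differentiable_zetaEntire.analyticAt s).deriv.differentiableAt).div
      differentiable_zetaEntire.differentiableAt hs
  have h2 : ∀ a : ℂ, a.re < s.re → DifferentiableAt ℂ (fun z => 1 / (z - a)) s := fun a ha =>
    (differentiableAt_const _).div (by fun_prop)
      fun h => by rw [sub_eq_zero.mp h] at ha; exact lt_irrefl _ ha
  refine h1.sub (DifferentiableAt.fun_sum fun ρ hρ => (DifferentiableAt.sub (h2 _ (hS ρ hρ))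
    (h2 _ ?_)).const_mul _)
  have := hS ρ hρ
  rw [sub_re, Complex.re_ofNat]
  linarith

section VerticalLine

variable {c δ : ℝ}

lemma exists_norm_regularizedLogDeriv_mul_smoothKernel_le :
    ∃ C : ℝ, 0 < C ∧ ∀ {c δ : ℝ}, 0 < δ → δ ≤ 1 → 1 / 2 ≤ c →
      (∀ ρ, zetaEntire ρ = 0 → 0 < ρ.re → ρ.re + δ ≤ c) → ∀ (N y : ℝ), 1 ≤ y → ∀ s : ℂ, c ≤ s.re →
      s.re ≤ 2 → ‖regularizedLogDeriv (zetaZeroFinset N) s * smoothKernel y s‖ ≤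
        C / δ * y ^ 3 * (1 + |s.im|) ^ (-(3 / 2) : ℝ) := by
  obtain ⟨C, hC, h⟩ := exists_norm_regularizedLogDeriv_le_div
  refine ⟨16 * C, by positivity, fun {c δ} hδ hδ1 hc hz N y hy s hcs hs2 => ?_⟩
  have h1 := h N δ s hδ hδ1 (hc.trans hcs) hs2 fun ρ h1 h2 => (hz ρ h1 h2).trans hcs
  have h2 := norm_smoothKernel_le hy (hc.trans hcs) hs2
  have h3 := logWeight_mul_rpow_le s.im
  rw [norm_mul]
  have hw := half_le_logWeight s.im
  calc _ ≤ (C / δ * logWeight s.im) * (8 * y ^ 3 * (1 + |s.im|) ^ (-2 : ℝ)) :=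
        mul_le_mul h1 h2 (norm_nonneg _) (by positivity)
    _ = C / δ * (8 * y ^ 3) * (logWeight s.im * (1 + |s.im|) ^ (-2 : ℝ)) := by ring
    _ ≤ C / δ * (8 * y ^ 3) * (2 * (1 + |s.im|) ^ (-(3 / 2) : ℝ)) := by gcongr
    _ = _ := by ring

lemma differentiableAt_regularizedLogDeriv_mul_smoothKernel (hδ : 0 < δ) (hc : 1 / 2 ≤ c)
    (hz : ∀ ρ, zetaEntire ρ = 0 → 0 < ρ.re → ρ.re + δ ≤ c) (N : ℝ) {y : ℝ} (hy : 1 ≤ y) {s : ℂ}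
    (hs : c ≤ s.re) : DifferentiableAt ℂ
      (fun s => regularizedLogDeriv (zetaZeroFinset N) s * smoothKernel y s) s := by
  refine DifferentiableAt.mul (differentiableAt_regularizedLogDeriv (fun h => ?_) fun ρ hρ => ?_)
    (differentiableAt_smoothKernel (by linarith) (by linarith))
  · have := hz s h (by linarith)
    linarith
  · rw [mem_zetaZeroFinset] at hρ
    have := hz ρ hρ.1 (by linarith [hρ.2.1])
    linarith

lemma integrable_regularizedLogDeriv_mul_smoothKernel (hδ : 0 < δ) (hδ1 : δ ≤ 1) (hc : 1 / 2 ≤ c)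
    (hc2 : c ≤ 2) (hz : ∀ ρ, zetaEntire ρ = 0 → 0 < ρ.re → ρ.re + δ ≤ c) (N : ℝ) {y : ℝ}
    (hy : 1 ≤ y) : Integrable fun t : ℝ =>
      regularizedLogDeriv (zetaZeroFinset N) (c + t * I) * smoothKernel y (c + t * I) := by
  obtain ⟨C, hC, h⟩ := exists_norm_regularizedLogDeriv_mul_smoothKernel_le
  refine integrable_of_norm_le_rpow (B := C / δ * y ^ 3) (continuous_line
    (F := fun s => regularizedLogDeriv (zetaZeroFinset N) s * smoothKernel y s) fun s hs =>
    differentiableAt_regularizedLogDeriv_mul_smoothKernel hδ hc hz N hy hs.ge) fun t => ?_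
  simpa using h hδ hδ1 hc hz N y hy (c + t * I) (by simp) (by simpa)

lemma re_add_one_le_two_of_zetaEntire_eq_zero {ρ : ℂ} (h : zetaEntire ρ = 0) : ρ.re + 1 ≤ 2 := by
  by_contra! h1
  exact zetaEntire_ne_zero_of_one_le_re (by linarith) h

/-- The smoothed explicit formula, truncated at height `N` and shifted to the line `Re s = c`. -/
lemma smoothPsi_eq (hδ : 0 < δ) (hδ1 : δ ≤ 1) (hc : 1 / 2 ≤ c)
    (hc2 : c ≤ 2) (hz : ∀ ρ, zetaEntire ρ = 0 → 0 < ρ.re → ρ.re + δ ≤ c) (N : ℝ) {y : ℝ}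
    (hy : 1 < y) : 2 * Real.pi * (smoothPsi y : ℂ) = 2 * Real.pi * poleTerm y 1 -
      ∑ ρ ∈ zetaZeroFinset N, (zeroMult ρ : ℂ) *
        (2 * Real.pi * poleTerm y ρ - 2 * Real.pi * poleTerm y (ρ - 3)) -
      ∫ t : ℝ, regularizedLogDeriv (zetaZeroFinset N) (c + t * I) * smoothKernel y (c + t * I) := by
  have hz2 : ∀ ρ, zetaEntire ρ = 0 → 0 < ρ.re → ρ.re + 1 ≤ 2 := fun ρ h _ =>
    re_add_one_le_two_of_zetaEntire_eq_zero h
  obtain ⟨C, hC, hb⟩ := exists_norm_regularizedLogDeriv_mul_smoothKernel_le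
  have hshift := integral_vertical_line_eq (a := c) (b := 2) (B := C / δ * y ^ 3)
    (F := fun s => regularizedLogDeriv (zetaZeroFinset N) s * smoothKernel y s) hc2
    (fun s h1 _ => differentiableAt_regularizedLogDeriv_mul_smoothKernel hδ hc hz N hy.le h1)
    fun s h1 h2 => hb hδ hδ1 hc hz N y hy.le s h1 h2
  simp only [ofReal_ofNat] at hshift
  have hR : Integrable fun t : ℝ => regularizedLogDeriv (zetaZeroFinset N) (2 + t * I) *
      smoothKernel y (2 + t * I) := by
    simpa using integrable_regularizedLogDeriv_mul_smoothKernel (c := 2) one_pos le_rfl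
      (by norm_num) le_rfl hz2 N hy.le
  rw [hshift, ← integral_LSeries_mul_smoothKernel hy.le]
  have hmem : ∀ ρ ∈ zetaZeroFinset N, 1 / 4 ≤ ρ.re ∧ ρ.re ≤ 1 := fun ρ hρ => by
    rw [mem_zetaZeroFinset] at hρ
    exact ⟨hρ.2.1, hρ.2.2.1⟩
  have hne : ∀ (ρ : ℂ) (x : ℝ), ρ.re ≠ x → ρ - x ≠ 0 := fun ρ x h h' => h (by
    rw [sub_eq_zero.mp h', ofReal_re])
  have e1 : ∀ ρ ∈ zetaZeroFinset N, ∫ t : ℝ, 1 / (2 + t * I - ρ) * smoothKernel y (2 + t * I) =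
      2 * Real.pi * poleTerm y ρ := fun ρ hρ =>
    integral_inv_sub_mul_smoothKernel hy (by linarith [hmem ρ hρ])
      (by simpa using hne ρ 0 (by linarith [hmem ρ hρ]))
      (by simpa using hne ρ (-1) (by linarith [hmem ρ hρ]))
  have e2 : ∀ ρ ∈ zetaZeroFinset N,
      ∫ t : ℝ, 1 / (2 + t * I - (ρ - 3)) * smoothKernel y (2 + t * I) =
      2 * Real.pi * poleTerm y (ρ - 3) := fun ρ hρ =>
    integral_inv_sub_mul_smoothKernel hy (by rw [sub_re, re_ofNat]; linarith [hmem ρ hρ])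
      (by simpa using hne ρ 3 (by linarith [hmem ρ hρ]))
      (by
        have := hne ρ 2 (by linarith [hmem ρ hρ])
        rwa [show ρ - 3 + 1 = ρ - (2 : ℝ) by push_cast; ring])
  have i1 : ∀ ρ ∈ zetaZeroFinset N,
      Integrable fun t : ℝ => 1 / (2 + t * I - ρ) * smoothKernel y (2 + t * I) := fun ρ hρ =>
    integrable_inv_sub_mul_smoothKernel hy.le (by linarith [hmem ρ hρ])
  have i2 : ∀ ρ ∈ zetaZeroFinset N,
      Integrable fun t : ℝ => 1 / (2 + t * I - (ρ - 3)) * smoothKernel y (2 + t * I) := fun ρ hρ =>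
    integrable_inv_sub_mul_smoothKernel hy.le (by rw [sub_re, re_ofNat]; linarith [hmem ρ hρ])
  have i3 : Integrable fun t : ℝ => 1 / (2 + t * I - 1) * smoothKernel y (2 + t * I) :=
    integrable_inv_sub_mul_smoothKernel hy.le (by simp)
  have i4 : ∀ ρ ∈ zetaZeroFinset N, Integrable fun t : ℝ => (zeroMult ρ : ℂ) *
      (1 / (2 + t * I - ρ) * smoothKernel y (2 + t * I) -
        1 / (2 + t * I - (ρ - 3)) * smoothKernel y (2 + t * I)) := fun ρ hρ =>
    ((i1 ρ hρ).sub (i2 ρ hρ)).const_mul _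
  have i5 := integrable_finsetSum _ i4
  have i6 := i3.sub' i5
  have hpt : ∀ t : ℝ, LSeries (fun n => (ArithmeticFunction.vonMangoldt n : ℂ)) (2 + t * I) *
      smoothKernel y (2 + t * I) = 1 / (2 + t * I - 1) * smoothKernel y (2 + t * I) -
      ∑ ρ ∈ zetaZeroFinset N, (zeroMult ρ : ℂ) * (1 / (2 + t * I - ρ) * smoothKernel y (2 + t * I) -
        1 / (2 + t * I - (ρ - 3)) * smoothKernel y (2 + t * I)) -
      regularizedLogDeriv (zetaZeroFinset N) (2 + t * I) * smoothKernel y (2 + t * I) := fun t => by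
    rw [LSeries_vonMangoldt_eq_sub (by rw [line_re]; norm_num), regularizedLogDeriv]
    simp_rw [← sub_mul, ← mul_assoc]
    rw [← Finset.sum_mul]
    ring
  simp_rw [hpt]
  rw [integral_sub i6 hR, integral_sub i3 i5, integral_finsetSum _ i4,
    integral_inv_sub_mul_smoothKernel hy (by simp) one_ne_zero (by norm_num)]
  congr 2
  refine Finset.sum_congr rfl fun ρ hρ => ?_
  rw [integral_const_mul, integral_sub (i1 ρ hρ) (i2 ρ hρ), e1 ρ hρ, e2 ρ hρ]

end VerticalLine

/-- The difference quotient of `y ↦ y ^ (a + 1) / (a * (a + 1))` with step `h`. -/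
noncomputable def powQuotient (y h : ℝ) (a : ℂ) : ℂ :=
  (((y + h : ℝ) : ℂ) ^ (a + 1) - (y : ℂ) ^ (a + 1)) / (h * (a * (a + 1)))

lemma smoothKernel_sub_eq {y h : ℝ} (hh : h ≠ 0) (s : ℂ) :
    smoothKernel (y + h) s - smoothKernel y s = h * powQuotient y h s := by
  have : (h : ℂ) ≠ 0 := by exact_mod_cast hh
  rw [smoothKernel, smoothKernel, powQuotient, ← sub_div, ← mul_div_assoc,
    mul_div_mul_left _ _ this]

lemma poleTerm_sub_eq {y h : ℝ} (hh : h ≠ 0) (a : ℂ) :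
    poleTerm (y + h) a - poleTerm y a = h * (powQuotient y h a - 1 / a) := by
  have h1 := smoothKernel_sub_eq (y := y) hh a
  rw [mul_sub, ← h1, poleTerm, poleTerm, smoothKernel, smoothKernel]
  generalize ((y + h : ℝ) : ℂ) ^ (a + 1) / (a * (a + 1)) = u
  generalize (y : ℂ) ^ (a + 1) / (a * (a + 1)) = v
  push_cast
  ring

lemma poleTerm_one (y : ℝ) : poleTerm y 1 = (((y - 1) ^ 2 / 2 : ℝ) : ℂ) := by
  rw [poleTerm, show (1 : ℂ) + 1 = (2 : ℕ) by norm_num, Complex.cpow_natCast]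
  push_cast
  ring_nf

lemma norm_cpow_sub_cpow_le {y h β : ℝ} (hy : 1 ≤ y) (hh : 0 ≤ h) {a : ℂ} (ha : a.re ≤ β)
    (hβ : 0 ≤ β) : ‖((y + h : ℝ) : ℂ) ^ (a + 1) - (y : ℂ) ^ (a + 1)‖ ≤
      ‖a + 1‖ * (y + h) ^ β * h := by
  rcases eq_or_ne (a + 1) 0 with h0 | h0
  · simp [h0]
  have hd : ∀ t ∈ Icc y (y + h), HasDerivWithinAt (fun t : ℝ => (t : ℂ) ^ (a + 1))
      ((a + 1) * (t : ℂ) ^ a) (Icc y (y + h)) t := by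
    intro t ht
    have ht0 : t ≠ 0 := by linarith [ht.1]
    have h1 := (hasDerivAt_ofReal_cpow_const' (r := a) ht0
      (fun h => h0 (by rw [h]; ring))).const_mul (a + 1)
    refine (h1.congr_of_eventuallyEq (Eventually.of_forall fun u => ?_)).hasDerivWithinAt
    field_simp
  have hb : ∀ t ∈ Icc y (y + h), ‖(a + 1) * (t : ℂ) ^ a‖ ≤ ‖a + 1‖ * (y + h) ^ β := by
    intro t ht
    have ht1 : 1 ≤ t := hy.trans ht.1
    rw [norm_mul, Complex.norm_cpow_eq_rpow_re_of_pos (by linarith)]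
    gcongr
    exact (Real.rpow_le_rpow_of_exponent_le ht1 ha).trans
      (Real.rpow_le_rpow (by linarith) ht.2 hβ)
  have := (convex_Icc y (y + h)).norm_image_sub_le_of_norm_hasDerivWithin_le hd hb
    (left_mem_Icc.mpr (by linarith)) (right_mem_Icc.mpr (by linarith))
  simpa [abs_of_nonneg hh] using this

lemma norm_powQuotient_le_div {y h β : ℝ} (hy : 1 ≤ y) (hh : 0 < h) {a : ℂ} (ha : a.re ≤ β)
    (hβ : 0 ≤ β) : ‖powQuotient y h a‖ ≤ (y + h) ^ β / ‖a‖ := by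
  rcases eq_or_ne (a + 1) 0 with h0 | h0
  · rw [powQuotient, h0]
    simp only [mul_zero, div_zero, norm_zero]
    positivity
  have h2 := norm_cpow_sub_cpow_le hy hh.le ha hβ
  have h3 : 0 < ‖a + 1‖ := norm_pos_iff.mpr h0
  rw [powQuotient, norm_div, norm_mul, norm_mul, norm_real, Real.norm_of_nonneg hh.le]
  calc _ ≤ ‖a + 1‖ * (y + h) ^ β * h / (h * (‖a‖ * ‖a + 1‖)) := by gcongr
    _ = _ := by
      rw [show ‖a + 1‖ * (y + h) ^ β * h = (y + h) ^ β * (h * ‖a + 1‖) by ring,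
        show h * (‖a‖ * ‖a + 1‖) = ‖a‖ * (h * ‖a + 1‖) by ring, mul_div_mul_right _ _ (by positivity)]

lemma norm_powQuotient_le_div_mul {y h : ℝ} (hy : 1 ≤ y) (hh : 0 < h) (a : ℂ) :
    ‖powQuotient y h a‖ ≤ ((y + h) ^ (a.re + 1) + y ^ (a.re + 1)) / (h * (‖a‖ * ‖a + 1‖)) := by
  rw [powQuotient, norm_div, norm_mul, norm_mul, norm_real, Real.norm_of_nonneg hh.le]
  gcongr
  refine (norm_sub_le _ _).trans_eq ?_
  rw [Complex.norm_cpow_eq_rpow_re_of_pos (by linarith),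
    Complex.norm_cpow_eq_rpow_re_of_pos (by linarith), add_re, one_re]

lemma one_add_abs_im_le {a : ℂ} {r : ℝ} (hr : 0 < r) (ha : r ≤ |a.re|) :
    1 + |a.im| ≤ (1 / r + 1) * ‖a‖ := by
  have h1 := (ha.trans (Complex.abs_re_le_norm a))
  have h2 := Complex.abs_im_le_norm a
  have h3 : 1 ≤ 1 / r * ‖a‖ := by rw [one_div, ← div_eq_inv_mul]; exact (one_le_div hr).mpr h1
  linarith

section

variable {y h β : ℝ}

lemma rpow_add_le (hy : 1 ≤ y) (hh : 0 ≤ h) (hhy : h ≤ y) (hβ : 0 ≤ β) (hβ2 : β ≤ 2) :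
    (y + h) ^ β ≤ 4 * y ^ β :=
  calc (y + h) ^ β ≤ (2 * y) ^ β := by gcongr; linarith
    _ = 2 ^ β * y ^ β := Real.mul_rpow (by norm_num) (by linarith)
    _ ≤ 2 ^ (2 : ℝ) * y ^ β := by gcongr; norm_num
    _ = _ := by norm_num

lemma norm_powQuotient_le_one (hy : 1 ≤ y) (hh : 0 < h) (hhy : h ≤ y) {a : ℂ} (ha1 : 1 / 4 ≤ a.re)
    (ha : a.re ≤ β) (hβ2 : β ≤ 2) : ‖powQuotient y h a‖ ≤ 20 * y ^ β / (1 + |a.im|) := by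
  have hβ : 0 ≤ β := by linarith
  have h1 := one_add_abs_im_le (a := a) (r := 1 / 4) (by norm_num) (ha1.trans (le_abs_self _))
  have h2 : 0 < 1 + |a.im| := by positivity
  have h3 : (1 + |a.im|) / 5 ≤ ‖a‖ := by norm_num at h1; linarith
  calc _ ≤ (y + h) ^ β / ‖a‖ := norm_powQuotient_le_div hy hh ha hβ
    _ ≤ 4 * y ^ β / ((1 + |a.im|) / 5) := by
      gcongr
      exact rpow_add_le hy hh.le hhy hβ hβ2
    _ = _ := by field_simp; norm_num

lemma norm_powQuotient_le_two (hy : 2 ≤ y) (hh : 2 ≤ h) (hhy : h ≤ y) {a : ℂ} (ha1 : 1 / 4 ≤ a.re)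
    (ha : a.re ≤ β) (hβ2 : β ≤ 2) :
    ‖powQuotient y h a‖ ≤ 80 * y ^ β * y / (1 + |a.im|) ^ 2 := by
  have hβ : 0 ≤ β := by linarith
  have h1 := one_add_abs_im_le (a := a) (r := 1 / 4) (by norm_num) (ha1.trans (le_abs_self _))
  have h1' := one_add_abs_im_le (a := a + 1) (r := 1) (by norm_num)
    (by rw [add_re, one_re]; exact le_trans (by linarith) (le_abs_self _))
  have h2 : 0 < 1 + |a.im| := by positivity
  have h3 : (1 + |a.im|) / 5 ≤ ‖a‖ := by norm_num at h1; linarith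
  have h3' : (1 + |a.im|) / 2 ≤ ‖a + 1‖ := by norm_num at h1'; linarith
  have hX : y + h ≤ y * h := by nlinarith
  have hr := rpow_add_le (by linarith) (by linarith) hhy hβ hβ2
  calc _ ≤ ((y + h) ^ (a.re + 1) + y ^ (a.re + 1)) / (h * (‖a‖ * ‖a + 1‖)) :=
        norm_powQuotient_le_div_mul (by linarith) (by linarith) a
    _ ≤ ((y + h) ^ (β + 1) + (y + h) ^ (β + 1)) /
        (h * ((1 + |a.im|) / 5 * ((1 + |a.im|) / 2))) := by
      gcongr ?_ / (h * (?_ * ?_))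
      refine add_le_add (Real.rpow_le_rpow_of_exponent_le (by linarith) (by linarith)) ?_
      exact (Real.rpow_le_rpow_of_exponent_le (by linarith) (by linarith)).trans
        (Real.rpow_le_rpow (by linarith) (by linarith) (by linarith))
    _ = 20 * ((y + h) ^ β * (y + h)) / (h * (1 + |a.im|) ^ 2) := by
      rw [Real.rpow_add_one (by linarith)]
      field_simp
      ring
    _ ≤ 20 * (4 * y ^ β * (y * h)) / (h * (1 + |a.im|) ^ 2) := by gcongr
    _ = _ := by
      field_simp
      ring

lemma norm_powQuotient_le_rpow {η : ℝ} (hy : 4 ≤ y) (hη : η = 1 / Real.log y) (hh : 2 ≤ h)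
    (hhy : h ≤ y) {a : ℂ} (ha1 : 1 / 4 ≤ a.re) (ha : a.re ≤ β) (hβ2 : β ≤ 2) :
    ‖powQuotient y h a‖ ≤ 240 * y ^ β * (1 + |a.im|) ^ (-1 - η) := by
  set b := 1 + |a.im| with hb
  have hb0 : 0 < b := by positivity
  have hl : 0 < Real.log y := Real.log_pos (by linarith)
  have hl1 : 1 ≤ Real.log y := by
    rw [Real.le_log_iff_exp_le (by linarith)]
    linarith [Real.exp_one_lt_d9]
  have hη0 : 0 < η := by rw [hη]; positivity
  have hye : y ^ η = Real.exp 1 := by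
    rw [Real.rpow_def_of_pos (by linarith), hη, mul_one_div_cancel hl.ne']
  have hy0 : 0 < y ^ β := Real.rpow_pos_of_pos (by linarith) _
  have he : Real.exp 1 ≤ 3 := by linarith [Real.exp_one_lt_d9]
  have hη1 : η ≤ 1 := by rw [hη, div_le_one hl]; exact hl1
  rcases le_total b y with hby | hby
  · have h1 : b ^ η ≤ 3 := (Real.rpow_le_rpow hb0.le hby hη0.le).trans (hye.trans_le he)
    have h2 : 0 < b ^ η := by positivity
    calc _ ≤ 20 * y ^ β / b := norm_powQuotient_le_one (by linarith) (by linarith) hhy ha1 ha hβ2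
      _ ≤ 20 * y ^ β / b * (3 / b ^ η) := le_mul_of_one_le_right (by positivity)
          ((one_le_div h2).mpr h1)
      _ = 60 * y ^ β * (1 / b / b ^ η) := by ring
      _ ≤ 240 * y ^ β * (1 / b / b ^ η) := by gcongr; norm_num
      _ = _ := by rw [Real.rpow_sub hb0, Real.rpow_neg_one, one_div]
  · have h1 : y / b ≤ (y / b) ^ η :=
      Real.self_le_rpow_of_le_one (by positivity) ((div_le_one hb0).mpr hby) hη1
    rw [Real.div_rpow (by linarith) hb0.le, hye] at h1
    calc _ ≤ 80 * y ^ β * y / b ^ 2 := norm_powQuotient_le_two (by linarith) hh hhy ha1 ha hβ2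
      _ = 80 * y ^ β / b * (y / b) := by field_simp
      _ ≤ 80 * y ^ β / b * (3 / b ^ η) := by
        gcongr 80 * y ^ β / b * ?_
        exact h1.trans (by gcongr)
      _ = 240 * y ^ β * (1 / b / b ^ η) := by ring
      _ = _ := by rw [Real.rpow_sub hb0, Real.rpow_neg_one, one_div]

lemma norm_powQuotient_sub_three_le (hy : 1 ≤ y) (hh : 1 ≤ h) {ρ : ℂ} (hρ : ρ.re ≤ 1) :
    ‖powQuotient y h (ρ - 3)‖ ≤ 8 / (1 + |ρ.im|) ^ 2 := by
  have h1 := one_add_abs_im_le (a := ρ - 3) (r := 1) (by norm_num)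
    (by rw [sub_re, re_ofNat, abs_of_nonpos (by linarith)]; linarith)
  have h1' := one_add_abs_im_le (a := ρ - 3 + 1) (r := 1) (by norm_num)
    (by rw [add_re, one_re, sub_re, re_ofNat, abs_of_nonpos (by linarith)]; linarith)
  have h2 : 0 < 1 + |ρ.im| := by positivity
  have h3 : (1 + |ρ.im|) / 2 ≤ ‖ρ - 3‖ := by norm_num at h1; linarith
  have h3' : (1 + |ρ.im|) / 2 ≤ ‖ρ - 3 + 1‖ := by norm_num at h1'; linarith
  have hre : (ρ - 3).re + 1 ≤ 0 := by rw [sub_re, re_ofNat]; linarith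
  calc _ ≤ ((y + h) ^ ((ρ - 3).re + 1) + y ^ ((ρ - 3).re + 1)) / (h * (‖ρ - 3‖ * ‖ρ - 3 + 1‖)) :=
        norm_powQuotient_le_div_mul hy (by linarith) _
    _ ≤ (1 + 1) / (1 * ((1 + |ρ.im|) / 2 * ((1 + |ρ.im|) / 2))) := by
      gcongr
      · exact Real.rpow_le_one_of_one_le_of_nonpos (by linarith) hre
      · exact Real.rpow_le_one_of_one_le_of_nonpos hy hre
    _ = _ := by field_simp; norm_num

lemma norm_inv_sub_inv_sub_three_le {ρ : ℂ} (h1 : 1 / 4 ≤ ρ.re) (h2 : ρ.re ≤ 1) :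
    ‖1 / ρ - 1 / (ρ - 3)‖ ≤ 30 / (1 + |ρ.im|) ^ 2 := by
  have h3 := one_add_abs_im_le (a := ρ) (r := 1 / 4) (by norm_num) (h1.trans (le_abs_self _))
  have h4 := one_add_abs_im_le (a := ρ - 3) (r := 1) (by norm_num)
    (by rw [sub_re, re_ofNat, abs_of_nonpos (by linarith)]; linarith)
  have hb : 0 < 1 + |ρ.im| := by positivity
  have h3' : (1 + |ρ.im|) / 5 ≤ ‖ρ‖ := by norm_num at h3; linarith
  have h4' : (1 + |ρ.im|) / 2 ≤ ‖ρ - 3‖ := by norm_num at h4; linarith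
  have h5 : ρ ≠ 0 := norm_pos_iff.mp (by linarith)
  have h6 : ρ - 3 ≠ 0 := norm_pos_iff.mp (by linarith)
  rw [show 1 / ρ - 1 / (ρ - 3) = -3 / (ρ * (ρ - 3)) by field_simp; ring, norm_div, norm_mul, norm_neg,
    Complex.norm_ofNat]
  calc _ ≤ 3 / ((1 + |ρ.im|) / 5 * ((1 + |ρ.im|) / 2)) := by gcongr
    _ = _ := by field_simp; norm_num

end

lemma one_sub_inv_rpow_le {a n : ℝ} (ha : 0 ≤ a) (ha1 : a ≤ 1) (hn : 0 < n) :
    a * (n + 1) ^ (-1 - a) ≤ n ^ (-a) - (n + 1) ^ (-a) := by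
  have hn1 : 0 < n + 1 := by linarith
  have h1 := rpow_one_add_le_one_add_mul_self (s := -(1 / (n + 1))) (p := a)
    (by rw [neg_le_neg_iff, div_le_one hn1]; linarith) ha ha1
  have h2 : 1 + -(1 / (n + 1)) = n / (n + 1) := by field_simp; ring
  rw [h2, Real.div_rpow hn.le hn1.le] at h1
  have h3 : 0 < n ^ a := by positivity
  have h4 : 0 < (n + 1) ^ a := by positivity
  rw [Real.rpow_sub hn1, Real.rpow_neg_one, Real.rpow_neg hn.le, Real.rpow_neg hn1.le]
  set q := n ^ a / (n + 1) ^ a with hq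
  set r := 1 / (n + 1) with hr
  have hq0 : 0 < q := by positivity
  have hr0 : 0 < r := by positivity
  have h5 : 1 + a * r ≤ 1 / q := by
    rw [le_div_iff₀ hq0]
    nlinarith [mul_le_mul_of_nonneg_left h1 (by positivity : 0 ≤ 1 + a * r), sq_nonneg (a * r)]
  have h6 : (n ^ a)⁻¹ = 1 / q * ((n + 1) ^ a)⁻¹ := by rw [hq]; field_simp
  rw [h6, show (n + 1)⁻¹ = r from (one_div _).symm]
  calc a * (r / (n + 1) ^ a) = (1 + a * r - 1) * ((n + 1) ^ a)⁻¹ := by ring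
    _ ≤ (1 / q - 1) * ((n + 1) ^ a)⁻¹ := by gcongr
    _ = _ := by ring

lemma sum_range_one_add_rpow_le {a : ℝ} (ha : 0 < a) (ha1 : a ≤ 1) (M : ℕ) :
    ∑ n ∈ Finset.range M, (1 + (n : ℝ)) ^ (-1 - a) ≤ 2 / a := by
  have h : ∀ M : ℕ, ∑ n ∈ Finset.range (M + 1), (1 + (n : ℝ)) ^ (-1 - a) ≤
      1 + 1 / a - 1 / a * ((M : ℝ) + 1) ^ (-a) := by
    intro M
    induction M with
    | zero => simp
    | succ k ih =>
      rw [Finset.sum_range_succ]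
      have h1 := one_sub_inv_rpow_le ha.le ha1 (n := (k : ℝ) + 1) (by positivity)
      have h2 : (1 + ((k + 1 : ℕ) : ℝ)) ^ (-1 - a) ≤
          1 / a * (((k : ℝ) + 1) ^ (-a) - ((k : ℝ) + 1 + 1) ^ (-a)) := by
        rw [one_div, ← div_eq_inv_mul, le_div_iff₀' ha]
        push_cast
        rwa [add_comm (1 : ℝ)]
      push_cast at h2 ⊢
      linarith
  have h2 : 1 ≤ 1 / a := (one_le_div ha).mpr ha1
  calc _ ≤ ∑ n ∈ Finset.range (M + 1), (1 + (n : ℝ)) ^ (-1 - a) :=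
        Finset.sum_le_sum_of_subset_of_nonneg (Finset.range_mono (by lia))
          fun _ _ _ => by positivity
    _ ≤ _ := h M
    _ ≤ 1 + 1 / a := by
      have : 0 ≤ 1 / a * ((M : ℝ) + 1) ^ (-a) := by positivity
      linarith
    _ ≤ 2 / a := by
      rw [show 2 / a = 1 / a + 1 / a by ring]
      linarith

lemma sum_comp_natAbs_le {w : ℕ → ℝ} (hw : ∀ n, 0 ≤ w n) {B : ℝ}
    (hB : ∀ M, ∑ n ∈ Finset.range M, w n ≤ B) (F : Finset ℤ) :
    ∑ k ∈ F, w k.natAbs ≤ 2 * B := by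
  rw [Finset.sum_comp w Int.natAbs]
  obtain ⟨M, hM⟩ := (F.image Int.natAbs).exists_nat_subset_range
  calc _ ≤ ∑ n ∈ F.image Int.natAbs, 2 * w n := by
        refine Finset.sum_le_sum fun n _ => ?_
        rw [nsmul_eq_mul]
        gcongr
        · exact hw n
        have hsub : F.filter (fun k => k.natAbs = n) ⊆ {(n : ℤ), -(n : ℤ)} := by
          intro k hk
          rw [Finset.mem_filter] at hk
          simp only [Finset.mem_insert, Finset.mem_singleton]
          lia
        exact_mod_cast (Finset.card_le_card hsub).trans Finset.card_le_two
    _ ≤ ∑ n ∈ Finset.range M, 2 * w n :=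
        Finset.sum_le_sum_of_subset_of_nonneg hM fun n _ _ => mul_nonneg zero_le_two (hw n)
    _ ≤ 2 * B := by
        rw [← Finset.mul_sum]
        gcongr
        exact hB M

lemma logWeight_mul_rpow_le_div {η : ℝ} (hη : 0 < η) (hη1 : η ≤ 1) (t : ℝ) :
    logWeight t * (1 + |t|) ^ (-1 - η) ≤ 4 / η * (1 + |t|) ^ (-1 - η / 2) := by
  have hb : 0 < 1 + |t| := by positivity
  have h1 : logWeight t ≤ 4 / η * (1 + |t|) ^ (η / 2) :=
    calc logWeight t ≤ (|t| + 2) ^ (η / 2) / (η / 2) :=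
          Real.log_le_rpow_div (by positivity) (by positivity)
      _ ≤ (2 * (1 + |t|)) ^ (η / 2) / (η / 2) := by
        gcongr
        linarith [abs_nonneg t]
      _ = 2 ^ (η / 2) * (1 + |t|) ^ (η / 2) / (η / 2) := by
        rw [Real.mul_rpow (by norm_num) hb.le]
      _ ≤ 2 ^ (1 : ℝ) * (1 + |t|) ^ (η / 2) / (η / 2) := by
        gcongr
        · norm_num
        · linarith
      _ = _ := by rw [Real.rpow_one]; ring
  calc _ ≤ 4 / η * (1 + |t|) ^ (η / 2) * (1 + |t|) ^ (-1 - η) := by gcongr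
    _ = 4 / η * (1 + |t|) ^ (-1 - η / 2) := by
      rw [mul_assoc, ← Real.rpow_add hb]
      ring_nf

lemma sum_logWeight_mul_rpow_le {η : ℝ} (hη : 0 < η) (hη1 : η ≤ 1) (F : Finset ℤ) :
    ∑ k ∈ F, logWeight k * (1 + |(k : ℝ)|) ^ (-1 - η) ≤ 32 / η ^ 2 := by
  have h := sum_comp_natAbs_le (w := fun n => (1 + (n : ℝ)) ^ (-1 - η / 2)) (fun _ => by positivity)
    (sum_range_one_add_rpow_le (a := η / 2) (by linarith) (by linarith)) F
  calc _ ≤ ∑ k ∈ F, 4 / η * (1 + (k.natAbs : ℝ)) ^ (-1 - η / 2) := by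
        refine Finset.sum_le_sum fun k _ => ?_
        rw [Nat.cast_natAbs, Int.cast_abs]
        exact logWeight_mul_rpow_le_div hη hη1 k
    _ ≤ 4 / η * (2 * (2 / (η / 2))) := by
        rw [← Finset.mul_sum]
        gcongr
    _ = _ := by field_simp; norm_num

lemma integrable_one_add_abs_rpow {a : ℝ} (ha : 0 < a) :
    Integrable fun t : ℝ => (1 + |t|) ^ (-1 - a) := by
  have := integrable_one_add_norm (E := ℝ) (μ := volume) (r := 1 + a) (by simp [ha])
  refine this.congr (Eventually.of_forall fun t => ?_)
  simp only [Real.norm_eq_abs]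
  ring_nf

lemma integral_one_add_abs_rpow {a : ℝ} (ha : 0 < a) :
    ∫ t : ℝ, (1 + |t|) ^ (-1 - a) = 2 / a := by
  have h := integral_comp_abs (f := fun t : ℝ => (1 + t) ^ (-1 - a))
  rw [h]
  have hd : ∀ t ∈ Ici (0 : ℝ), HasDerivAt (fun t : ℝ => -(1 / a) * (1 + t) ^ (-a))
      ((1 + t) ^ (-1 - a)) t := by
    intro t ht
    have ht' : (1 : ℝ) + t ≠ 0 := by have : 0 ≤ t := ht; positivity
    have h1 := (((hasDerivAt_id t).const_add 1).rpow_const (p := -a) (Or.inl ht')).const_mul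
      (-(1 / a))
    refine h1.congr_deriv ?_
    rw [show -a - 1 = -1 - a by ring]
    simp only [id]
    field_simp
  have hi : IntegrableOn (fun t : ℝ => (1 + t) ^ (-1 - a)) (Ioi 0) := by
    refine (integrable_one_add_abs_rpow ha).integrableOn.congr_fun (fun t ht => ?_) measurableSet_Ioi
    simp only [abs_of_pos (mem_Ioi.mp ht)]
  have hl : Tendsto (fun t : ℝ => -(1 / a) * (1 + t) ^ (-a)) atTop (𝓝 (-(1 / a) * 0)) :=
    ((tendsto_rpow_neg_atTop ha).comp (tendsto_atTop_add_const_left _ 1 tendsto_id)).const_mul _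
  rw [integral_Ioi_of_hasDerivAt_of_tendsto' hd hi hl]
  simp
  ring

lemma norm_integral_le_of_norm_le_logWeight {f : ℝ → ℂ} {η B : ℝ} (hη : 0 < η) (hη1 : η ≤ 1)
    (hB : 0 ≤ B) (hf : ∀ t, ‖f t‖ ≤ B * (logWeight t * (1 + |t|) ^ (-1 - η))) :
    ‖∫ t, f t‖ ≤ B * (16 / η ^ 2) := by
  calc _ ≤ ∫ t : ℝ, B * (4 / η * (1 + |t|) ^ (-1 - η / 2)) := by
        refine norm_integral_le_of_norm_le
          (((integrable_one_add_abs_rpow (by linarith)).const_mul _).const_mul _)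
          (Eventually.of_forall fun t => (hf t).trans ?_)
        gcongr B * ?_
        exact logWeight_mul_rpow_le_div hη hη1 t
    _ = _ := by
        rw [integral_const_mul, integral_const_mul, integral_one_add_abs_rpow (by linarith)]
        field_simp
        ring

lemma exists_sum_zeroMult_mul_rpow_le : ∃ A : ℝ, 0 < A ∧ ∀ (S : Finset ℂ) (η : ℝ), 0 < η → η ≤ 1 →
    (∀ ρ ∈ S, 1 / 4 ≤ ρ.re ∧ ρ.re ≤ 1) →
    ∑ ρ ∈ S, (zeroMult ρ : ℝ) * (1 + |ρ.im|) ^ (-1 - η) ≤ A / η ^ 2 := by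
  obtain ⟨A, hA, h⟩ := exists_sum_zeroMult_mul_le
  refine ⟨4 * A * 32, by positivity, fun S η hη hη1 hS => ?_⟩
  have h1 := h S (fun k => (1 + |(k : ℝ)|) ^ (-1 - η)) _ hS (fun k => by positivity)
    (sum_logWeight_mul_rpow_le hη hη1)
  calc _ ≤ ∑ ρ ∈ S, 4 * ((zeroMult ρ : ℝ) * (1 + |((round ρ.im : ℤ) : ℝ)|) ^ (-1 - η)) := by
        refine Finset.sum_le_sum fun ρ _ => ?_
        rw [mul_left_comm]
        gcongr
        have h2 : (1 + |((round ρ.im : ℤ) : ℝ)|) / 2 ≤ 1 + |ρ.im| := by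
          have h3 := abs_sub_round ρ.im
          have h4 := abs_sub_abs_le_abs_sub ((round ρ.im : ℤ) : ℝ) ρ.im
          rw [abs_sub_comm] at h4
          linarith [abs_nonneg ρ.im]
        calc _ ≤ ((1 + |((round ρ.im : ℤ) : ℝ)|) / 2) ^ (-1 - η) :=
              Real.rpow_le_rpow_of_nonpos (by positivity) h2 (by linarith)
          _ = (1 / 2) ^ (-1 - η) * (1 + |((round ρ.im : ℤ) : ℝ)|) ^ (-1 - η) := by
              rw [div_eq_mul_one_div, Real.mul_rpow (by positivity) (by norm_num), mul_comm]
          _ ≤ 4 * (1 + |((round ρ.im : ℤ) : ℝ)|) ^ (-1 - η) := by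
              gcongr
              calc ((1 : ℝ) / 2) ^ (-1 - η) ≤ (1 / 2) ^ (-2 : ℝ) :=
                    Real.rpow_le_rpow_of_exponent_ge (by norm_num) (by norm_num) (by linarith)
                _ = 4 := by
                    rw [Real.rpow_neg (by norm_num), Real.rpow_ofNat]
                    norm_num
    _ ≤ 4 * (A * (32 / η ^ 2)) := by
        rw [← Finset.mul_sum]
        gcongr
    _ = _ := by ring

section

variable {y h η : ℝ}

lemma rpow_sq_le_rpow_neg_one_sub {b : ℝ} (hb : 1 ≤ b) (hη1 : η ≤ 1) :
    1 / b ^ 2 ≤ b ^ (-1 - η) := by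
  rw [one_div, ← Real.rpow_natCast, ← Real.rpow_neg (by linarith)]
  refine Real.rpow_le_rpow_of_exponent_le hb ?_
  push_cast
  linarith

/-- The increment of the smoothed Chebyshev function. -/
lemma smoothPsi_sub_eq {c δ : ℝ} (hδ : 0 < δ) (hδ1 : δ ≤ 1) (hc : 1 / 2 ≤ c) (hc2 : c ≤ 2)
    (hz : ∀ ρ, zetaEntire ρ = 0 → 0 < ρ.re → ρ.re + δ ≤ c) (N : ℝ) (hy : 1 < y) (hh : 0 < h) :
    2 * Real.pi * (((smoothPsi (y + h) - smoothPsi y) / h - (y + (h / 2 - 1)) : ℝ) : ℂ) =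
      - ∑ ρ ∈ zetaZeroFinset N, (zeroMult ρ : ℂ) * (2 * Real.pi *
        (powQuotient y h ρ - powQuotient y h (ρ - 3) - (1 / ρ - 1 / (ρ - 3)))) -
      ∫ t : ℝ, regularizedLogDeriv (zetaZeroFinset N) (c + t * I) * powQuotient y h (c + t * I) := by
  have hh' : (h : ℂ) ≠ 0 := by exact_mod_cast hh.ne'
  have e1 := smoothPsi_eq hδ hδ1 hc hc2 hz N (y := y + h) (by linarith)
  have e2 := smoothPsi_eq hδ hδ1 hc hc2 hz N hy
  have i1 := integrable_regularizedLogDeriv_mul_smoothKernel hδ hδ1 hc hc2 hz N (y := y + h)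
    (by linarith)
  have i2 := integrable_regularizedLogDeriv_mul_smoothKernel hδ hδ1 hc hc2 hz N hy.le
  have hI := integral_sub i1 i2
  simp_rw [← mul_sub, smoothKernel_sub_eq hh.ne', mul_left_comm _ (h : ℂ)] at hI
  rw [integral_const_mul] at hI
  have hS : ∑ ρ ∈ zetaZeroFinset N, (zeroMult ρ : ℂ) *
        (2 * Real.pi * poleTerm (y + h) ρ - 2 * Real.pi * poleTerm (y + h) (ρ - 3)) -
      ∑ ρ ∈ zetaZeroFinset N, (zeroMult ρ : ℂ) *
        (2 * Real.pi * poleTerm y ρ - 2 * Real.pi * poleTerm y (ρ - 3)) =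
      h * ∑ ρ ∈ zetaZeroFinset N, (zeroMult ρ : ℂ) * (2 * Real.pi *
        (powQuotient y h ρ - powQuotient y h (ρ - 3) - (1 / ρ - 1 / (ρ - 3)))) := by
    rw [← Finset.sum_sub_distrib, Finset.mul_sum]
    refine Finset.sum_congr rfl fun ρ _ => ?_
    have h1 := poleTerm_sub_eq (y := y) hh.ne' ρ
    have h2 := poleTerm_sub_eq (y := y) hh.ne' (ρ - 3)
    linear_combination (zeroMult ρ : ℂ) * (2 * Real.pi) * (h1 - h2)
  have hP : poleTerm (y + h) 1 - poleTerm y 1 = h * ((y + (h / 2 - 1) : ℝ) : ℂ) := by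
    rw [poleTerm_one, poleTerm_one]
    push_cast
    ring
  refine mul_left_cancel₀ hh' ?_
  push_cast at hP ⊢
  rw [mul_sub (h : ℂ), mul_neg, ← hS, hI, mul_left_comm, mul_sub (h : ℂ), mul_div_cancel₀ _ hh', ← hP]
  linear_combination e1 - e2

variable {θ : ℝ}

lemma norm_zero_term_le (hy : 4 ≤ y) (hη : η = 1 / Real.log y) (hη1 : η ≤ 1) (hh : 2 ≤ h)
    (hhy : h ≤ y) {ρ : ℂ} (h1 : 1 / 4 ≤ ρ.re) (h2 : ρ.re ≤ 1) (hθ : ρ.re ≤ θ) (hθ1 : θ ≤ 1) :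
    ‖2 * Real.pi * (powQuotient y h ρ - powQuotient y h (ρ - 3) - (1 / ρ - 1 / (ρ - 3)))‖ ≤
      2 * Real.pi * (278 * y ^ θ * (1 + |ρ.im|) ^ (-1 - η)) := by
  have a1 := norm_powQuotient_le_rpow hy hη hh hhy h1 hθ (by linarith)
  have a2 := norm_powQuotient_sub_three_le (y := y) (h := h) (by linarith) (by linarith) h2
  have a3 := norm_inv_sub_inv_sub_three_le h1 h2
  have a4 := rpow_sq_le_rpow_neg_one_sub (b := 1 + |ρ.im|) (by linarith [abs_nonneg ρ.im]) hη1
  have a5 : 1 ≤ y ^ θ := Real.one_le_rpow (by linarith) (by linarith)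
  have a6 : 1 / (1 + |ρ.im|) ^ 2 ≤ y ^ θ * (1 + |ρ.im|) ^ (-1 - η) :=
    a4.trans (le_mul_of_one_le_left (by positivity) a5)
  rw [norm_mul, norm_mul, Complex.norm_two, norm_real, Real.norm_of_nonneg Real.pi_pos.le]
  gcongr
  calc _ ≤ ‖powQuotient y h ρ‖ + ‖powQuotient y h (ρ - 3)‖ + ‖1 / ρ - 1 / (ρ - 3)‖ :=
        (norm_sub_le _ _).trans (add_le_add_left (norm_sub_le _ _) _)
    _ ≤ 240 * y ^ θ * (1 + |ρ.im|) ^ (-1 - η) + 8 / (1 + |ρ.im|) ^ 2 + 30 / (1 + |ρ.im|) ^ 2 := by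
        gcongr
    _ = 240 * (y ^ θ * (1 + |ρ.im|) ^ (-1 - η)) + 38 * (1 / (1 + |ρ.im|) ^ 2) := by ring
    _ ≤ _ := by linarith

/-- At a height `N` large in terms of `y`, the regularized logarithmic derivative against the
difference quotient has an `N`-independent majorant on the vertical line. -/
lemma exists_norm_regularizedLogDeriv_mul_powQuotient_le : ∃ C : ℝ, 0 < C ∧
    ∀ {y h η c : ℝ}, 16 ≤ y → η = 1 / Real.log y → 2 ≤ h → h ≤ y → 1 / 2 ≤ c → c ≤ 2 →
    (∀ ρ, zetaEntire ρ = 0 → 0 < ρ.re → ρ.re + η ≤ c) → ∀ t : ℝ,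
    ‖regularizedLogDeriv (zetaZeroFinset (y ^ 4 + 2)) (c + t * I) * powQuotient y h (c + t * I)‖ ≤
      C * y ^ c * (logWeight t * (1 + |t|) ^ (-1 - η)) := by
  obtain ⟨C₁, hC₁, h1⟩ := exists_norm_regularizedLogDeriv_le
  obtain ⟨C₂, hC₂, h2⟩ := exists_norm_regularizedLogDeriv_le_div
  refine ⟨240 * C₁ + 80 * C₂, by positivity, fun {y h η c} hy hη hh hhy hc hc2 hz t => ?_⟩
  have hl2 : 2 ≤ Real.log y := by
    rw [Real.le_log_iff_exp_le (by linarith), show (2 : ℝ) = 1 + 1 by norm_num, Real.exp_add]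
    nlinarith [Real.exp_one_lt_d9, Real.exp_pos 1]
  have hly : Real.log y ≤ y := (Real.log_le_sub_one_of_pos (by linarith)).trans (by linarith)
  have hη0 : 0 < η := by rw [hη]; positivity
  have hη1 : η ≤ 1 / 2 := by rw [hη]; gcongr
  have hηl : 1 / η = Real.log y := by rw [hη, one_div_one_div]
  set s : ℂ := c + t * I with hs
  have hre : s.re = c := by simp [hs]
  have him : s.im = t := by simp [hs]
  have hw := half_le_logWeight t
  have hyc : 0 < y ^ c := Real.rpow_pos_of_pos (by linarith) _
  have hb : 0 < 1 + |t| := by positivity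
  rw [norm_mul]
  rcases le_or_gt |t| (y ^ 4) with ht | ht
  · have b1 := h1 (y ^ 4 + 2) s (by rw [hre]; exact hc) (by rw [hre]; exact hc2)
      (fun h0 => by
        have := hz s h0 (by rw [hre]; linarith)
        linarith)
      (by rw [him]; linarith)
    have b2 := norm_powQuotient_le_rpow (by linarith) hη hh hhy (a := s) (β := c)
      (by rw [hre]; linarith) hre.le hc2
    rw [him] at b1 b2
    calc _ ≤ (C₁ * logWeight t) * (240 * y ^ c * (1 + |t|) ^ (-1 - η)) :=
          mul_le_mul b1 b2 (norm_nonneg _) (by positivity)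
      _ = 240 * C₁ * (y ^ c * (logWeight t * (1 + |t|) ^ (-1 - η))) := by ring
      _ ≤ (240 * C₁ + 80 * C₂) * (y ^ c * (logWeight t * (1 + |t|) ^ (-1 - η))) := by
        gcongr
        linarith
      _ = _ := by ring
  · have b1 := h2 (y ^ 4 + 2) η s hη0 (by linarith) (by rw [hre]; exact hc) (by rw [hre]; exact hc2)
      (by rw [hre]; exact hz)
    have b2 := norm_powQuotient_le_two (by linarith) hh hhy (a := s) (β := c)
      (by rw [hre]; linarith) hre.le hc2
    rw [him] at b1 b2
    have b3 : y * (1 / η) * (1 / (1 + |t|) ^ 2) ≤ (1 + |t|) ^ (-1 - η) := by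
      have e1 : y ^ 2 ≤ (1 + |t|) ^ (1 / 2 : ℝ) := by
        rw [← Real.sqrt_eq_rpow]
        refine Real.le_sqrt_of_sq_le ?_
        linarith [show (y ^ 2) ^ 2 = y ^ 4 by ring]
      have e2 : y * (1 / η) ≤ (1 + |t|) ^ (1 - η) := by
        rw [hηl]
        calc y * Real.log y ≤ y ^ 2 := by nlinarith
          _ ≤ _ := e1
          _ ≤ _ := Real.rpow_le_rpow_of_exponent_le (by linarith [abs_nonneg t]) (by linarith)
      calc _ ≤ (1 + |t|) ^ (1 - η) * (1 / (1 + |t|) ^ 2) := by gcongr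
        _ = (1 + |t|) ^ (-1 - η) := by
          rw [one_div, ← Real.rpow_natCast, ← Real.rpow_neg hb.le, ← Real.rpow_add hb]
          push_cast
          ring_nf
    calc _ ≤ (C₂ / η * logWeight t) * (80 * y ^ c * y / (1 + |t|) ^ 2) :=
          mul_le_mul b1 b2 (norm_nonneg _) (by positivity)
      _ = 80 * C₂ * (y ^ c * (logWeight t * (y * (1 / η) * (1 / (1 + |t|) ^ 2)))) := by
        field_simp
      _ ≤ (240 * C₁ + 80 * C₂) * (y ^ c * (logWeight t * (1 + |t|) ^ (-1 - η))) := by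
        gcongr
        linarith
      _ = _ := by ring

lemma exists_abs_smoothPsi_sub_le (hθ : 1 / 2 ≤ θ) (hθ1 : θ ≤ 1)
    (hz : ∀ ρ, zetaEntire ρ = 0 → 0 < ρ.re → ρ.re ≤ θ) : ∃ C : ℝ, 0 < C ∧ ∀ y h : ℝ, 16 ≤ y →
      2 ≤ h → h ≤ y → |(smoothPsi (y + h) - smoothPsi y) / h - (y + (h / 2 - 1))| ≤
        C * y ^ θ * Real.log y ^ 2 := by
  obtain ⟨A, hA, hsum⟩ := exists_sum_zeroMult_mul_rpow_le
  obtain ⟨C, hC, hR⟩ := exists_norm_regularizedLogDeriv_mul_powQuotient_le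
  refine ⟨278 * A + 3 * C * 16, by positivity, fun y h hy hh hhy => ?_⟩
  have hl1 : 1 ≤ Real.log y := by
    rw [Real.le_log_iff_exp_le (by linarith)]
    linarith [Real.exp_one_lt_d9]
  set η := 1 / Real.log y with hη
  have hη0 : 0 < η := by positivity
  have hη1 : η ≤ 1 := by rw [hη]; exact (div_le_one (by linarith)).mpr hl1
  have hηl : 1 / η ^ 2 = Real.log y ^ 2 := by rw [hη]; field_simp
  have hz' : ∀ ρ, zetaEntire ρ = 0 → 0 < ρ.re → ρ.re + η ≤ θ + η := fun ρ h1 h2 => by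
    linarith [hz ρ h1 h2]
  have hyc : y ^ (θ + η) ≤ 3 * y ^ θ := by
    have : y ^ η = Real.exp 1 := by
      rw [Real.rpow_def_of_pos (by linarith), hη, mul_one_div_cancel (by linarith)]
    rw [Real.rpow_add (by linarith), this, mul_comm]
    gcongr
    linarith [Real.exp_one_lt_d9]
  have hyθ : 0 < y ^ θ := Real.rpow_pos_of_pos (by linarith) _
  have hmem : ∀ ρ ∈ zetaZeroFinset (y ^ 4 + 2), zetaEntire ρ = 0 ∧ 1 / 4 ≤ ρ.re ∧ ρ.re ≤ 1 :=
    fun ρ hρ => by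
      rw [mem_zetaZeroFinset] at hρ
      exact ⟨hρ.1, hρ.2.1, hρ.2.2.1⟩
  have e := smoothPsi_sub_eq hη0 hη1 (by linarith) (by linarith) hz' (y ^ 4 + 2) (y := y) (h := h)
    (by linarith) (by linarith)
  have b1 := norm_sum_zeroMult_mul_le (S := zetaZeroFinset (y ^ 4 + 2)) fun ρ hρ =>
    norm_zero_term_le (by linarith) hη hη1 hh hhy (hmem ρ hρ).2.1 (hmem ρ hρ).2.2
      (hz ρ (hmem ρ hρ).1 (by linarith [(hmem ρ hρ).2.1])) hθ1
  have b2 := hsum (zetaZeroFinset (y ^ 4 + 2)) η hη0 hη1 fun ρ hρ => (hmem ρ hρ).2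
  have b3 := norm_integral_le_of_norm_le_logWeight hη0 hη1
    (f := fun t : ℝ => regularizedLogDeriv (zetaZeroFinset (y ^ 4 + 2)) ((θ + η : ℝ) + t * I) *
      powQuotient y h ((θ + η : ℝ) + t * I)) (B := C * y ^ (θ + η)) (by positivity)
    fun t => hR hy hη hh hhy (by linarith) (by linarith) hz' t
  set E := (smoothPsi (y + h) - smoothPsi y) / h - (y + (h / 2 - 1)) with hE
  have hpi := Real.two_le_pi
  have hn : ‖2 * Real.pi * (E : ℂ)‖ = 2 * Real.pi * |E| := by
    rw [norm_mul, norm_mul, Complex.norm_two, norm_real, norm_real,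
      Real.norm_of_nonneg Real.pi_pos.le, Real.norm_eq_abs]
  rw [e] at hn
  have hpi2 : 0 < 2 * Real.pi := by linarith
  refine le_of_mul_le_mul_left ?_ hpi2
  rw [← hn]
  calc _ ≤ _ + _ := norm_sub_le _ _
    _ ≤ 2 * Real.pi * (278 * y ^ θ * (A / η ^ 2)) + C * (3 * y ^ θ) * (16 / η ^ 2) := by
      refine add_le_add ?_ (b3.trans (by gcongr))
      rw [norm_neg]
      refine b1.trans ?_
      calc _ = 2 * Real.pi * (278 * y ^ θ * ∑ ρ ∈ zetaZeroFinset (y ^ 4 + 2),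
            (zeroMult ρ : ℝ) * (1 + |ρ.im|) ^ (-1 - η)) := by
            simp_rw [Finset.mul_sum]
            exact Finset.sum_congr rfl fun ρ _ => by ring
        _ ≤ _ := by gcongr
    _ = 2 * Real.pi * (278 * A * y ^ θ * (1 / η ^ 2)) + 3 * C * 16 * y ^ θ * (1 / η ^ 2) := by ring
    _ ≤ 2 * Real.pi * (278 * A * y ^ θ * (1 / η ^ 2)) +
        2 * Real.pi * (3 * C * 16 * y ^ θ * (1 / η ^ 2)) :=
      add_le_add le_rfl (le_mul_of_one_le_left (by positivity) (by linarith))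
    _ = _ := by rw [hηl]; ring

end

lemma sum_vonMangoldt_mul_le {y h : ℝ} (hy : 0 ≤ y) (hh : 0 ≤ h) :
    (∑ n ∈ Finset.Iic ⌊y⌋₊, ArithmeticFunction.vonMangoldt n) * h ≤
      smoothPsi (y + h) - smoothPsi y := by
  have hyh : y < (⌊y + h⌋₊ : ℝ) + 1 :=
    lt_of_le_of_lt (by linarith) (Nat.lt_floor_add_one (y + h))
  rw [smoothPsi_eq_sum (Nat.lt_floor_add_one (y + h)), smoothPsi_eq_sum hyh,
    ← Finset.sum_sub_distrib, Finset.sum_mul]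
  refine (Finset.sum_le_sum fun n hn => ?_).trans (Finset.sum_le_sum_of_subset_of_nonneg
    (Finset.Iic_subset_Iic.mpr (Nat.floor_le_floor (by linarith : y ≤ y + h))) fun n _ _ => ?_)
  · have : (n : ℝ) ≤ y := (Nat.le_floor_iff hy).mp (Finset.mem_Iic.mp hn)
    rw [max_eq_right (by linarith), max_eq_right (by linarith)]
    exact le_of_eq (by ring)
  · rw [← mul_sub]
    exact mul_nonneg ArithmeticFunction.vonMangoldt_nonneg
      (sub_nonneg.mpr (max_le_max le_rfl (by linarith)))

lemma le_sum_vonMangoldt_mul {y h : ℝ} (hh : 0 ≤ h) :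
    smoothPsi (y + h) - smoothPsi y ≤
      (∑ n ∈ Finset.Iic ⌊y + h⌋₊, ArithmeticFunction.vonMangoldt n) * h := by
  have hyh : y < (⌊y + h⌋₊ : ℝ) + 1 :=
    lt_of_le_of_lt (by linarith) (Nat.lt_floor_add_one (y + h))
  rw [smoothPsi_eq_sum (Nat.lt_floor_add_one (y + h)), smoothPsi_eq_sum hyh,
    ← Finset.sum_sub_distrib, Finset.sum_mul]
  refine Finset.sum_le_sum fun n _ => ?_
  rw [← mul_sub]
  gcongr
  rw [sub_le_iff_le_add]
  exact max_le (add_nonneg hh (le_max_left _ _)) (by linarith [le_max_right 0 (y - n)])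

lemma exists_abs_psi_sub_le_of_large {θ : ℝ} (hθ : 1 / 2 ≤ θ) (hθ1 : θ ≤ 1)
    (hz : ∀ ρ, zetaEntire ρ = 0 → 0 < ρ.re → ρ.re ≤ θ) : ∃ C : ℝ, 0 < C ∧ ∀ x : ℝ, 36 ≤ x →
      |(∑ n ∈ Finset.Iic ⌊x⌋₊, ArithmeticFunction.vonMangoldt n) - x| ≤
        C * x ^ θ * Real.log x ^ 2 := by
  obtain ⟨C, hC, h⟩ := exists_abs_smoothPsi_sub_le hθ hθ1 hz
  refine ⟨C + 2, by positivity, fun x hx => ?_⟩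
  set q := √x with hq
  have hqx : q ^ 2 = x := Real.sq_sqrt (by linarith)
  have hq6 : 6 ≤ q := Real.le_sqrt_of_sq_le (by linarith)
  have hl : ∀ y : ℝ, 16 ≤ y → 1 ≤ Real.log y := fun y hy => by
    rw [Real.le_log_iff_exp_le (by linarith)]
    linarith [Real.exp_one_lt_d9]
  have hlx := hl x (by linarith)
  have hqθ : q ≤ x ^ θ * Real.log x ^ 2 :=
    calc q = x ^ (1 / 2 : ℝ) := Real.sqrt_eq_rpow x
      _ ≤ x ^ θ := Real.rpow_le_rpow_of_exponent_le (by linarith) hθ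
      _ ≤ _ := le_mul_of_one_le_right (by positivity) (one_le_pow₀ hlx)
  have u1 := h x q (by linarith) (by linarith) (by nlinarith)
  have u2 := sum_vonMangoldt_mul_le (y := x) (h := q) (by linarith) (by linarith)
  rw [← le_div_iff₀ (by linarith)] at u2
  have hy : 16 ≤ x - q := by nlinarith
  have l1 := h (x - q) q hy (by linarith) (by nlinarith)
  have l2 := le_sum_vonMangoldt_mul (y := x - q) (h := q) (by linarith)
  rw [← div_le_iff₀ (by linarith)] at l2
  rw [sub_add_cancel] at l1 l2
  have l3 : C * (x - q) ^ θ * Real.log (x - q) ^ 2 ≤ C * x ^ θ * Real.log x ^ 2 := by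
    have := hl _ hy
    gcongr <;> linarith
  rw [abs_le] at u1 l1 ⊢
  constructor
  · linarith [l1.1]
  · linarith [u1.2]

end

/-- (Conditional bound for `ψ(x)`.)  Fix `ε` with `0 ≤ ε < 1/2`.  If every
zero `s` of the Riemann zeta function with `0 < Re s < 1` satisfies `Re s ≤ 1/2 + ε`, then
there is a constant `C > 0` such that for all real `x ≥ 2`,
`|ψ(x) - x| ≤ C · x^(1/2+ε) · (log x)²`, where `ψ(x) = ∑_{n ≤ x} Λ(n)` is the Chebyshev
function. -/
theorem psi_bound_of_weak_RH (ε : ℝ) (hε0 : 0 ≤ ε) (hε : ε < 1 / 2)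
    (hzeta : ∀ s : ℂ, riemannZeta s = 0 → 0 < s.re → s.re < 1 → s.re ≤ 1 / 2 + ε) :
    ∃ C : ℝ, 0 < C ∧ ∀ x : ℝ, 2 ≤ x →
      |(∑ n ∈ Finset.Iic ⌊x⌋₊, ArithmeticFunction.vonMangoldt n) - x| ≤
        C * x ^ (1 / 2 + ε) * Real.log x ^ 2 := by
  obtain ⟨C, hC, h⟩ := exists_abs_psi_sub_le_of_large (θ := 1 / 2 + ε) (by linarith) (by linarith)
    fun ρ h1 h2 => re_le_of_zetaEntire_eq_zero hzeta h1 h2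
  set D := (∑ n ∈ Finset.Iic 36, ArithmeticFunction.vonMangoldt n) + 36 with hD
  have hpos : ∀ s : Finset ℕ, 0 ≤ ∑ n ∈ s, ArithmeticFunction.vonMangoldt n := fun s =>
    Finset.sum_nonneg fun _ _ => ArithmeticFunction.vonMangoldt_nonneg
  have hD0 : 0 ≤ D := add_nonneg (hpos _) (by norm_num)
  have hl2 : 0 < Real.log 2 := Real.log_pos (by norm_num)
  refine ⟨C + D / Real.log 2 ^ 2, by positivity, fun x hx => ?_⟩
  have hlx : Real.log 2 ≤ Real.log x := Real.log_le_log (by norm_num) hx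
  rcases le_total 36 x with hx36 | hx36
  · refine (h x hx36).trans ?_
    gcongr
    exact le_add_of_nonneg_right (by positivity)
  · have h1 : ∑ n ∈ Finset.Iic ⌊x⌋₊, ArithmeticFunction.vonMangoldt n ≤
        ∑ n ∈ Finset.Iic 36, ArithmeticFunction.vonMangoldt n :=
      Finset.sum_le_sum_of_subset_of_nonneg
        (Finset.Iic_subset_Iic.mpr (Nat.floor_le_of_le (by exact_mod_cast hx36)))
        fun _ _ _ => ArithmeticFunction.vonMangoldt_nonneg
    have h2 := hpos (Finset.Iic ⌊x⌋₊)
    calc _ ≤ D := by rw [abs_le]; constructor <;> linarith [hpos (Finset.Iic 36)]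
      _ = D / Real.log 2 ^ 2 * 1 * Real.log 2 ^ 2 := by field_simp
      _ ≤ (C + D / Real.log 2 ^ 2) * x ^ (1 / 2 + ε) * Real.log x ^ 2 := by
        gcongr
        · linarith
        · exact Real.one_le_rpow (by linarith) (by linarith)
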